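/- arXiv:2305.18987 — 2 statements merged into one kernel-verified Lean document; each statement's English description precedes it below -/
import Mathlib

section
/- Let 1 < α ≤ 2, n ≥ 3 and ε ∈ (0,1). There exists a constant C > 0 depending only on α and ε such that: if ρ_{t_0} ≥ C·{√(p/min(t_0, n−t_0)) + (p/min(t_0, n−t_0))^{(α−1)/α} + (log log(n)/min(t_0, n−t_0))^{(α−1)/α}} for every t_0 ∈ [n−1], then there exists a measurable test φ : ℝ^{p×n} → {0,1} with R_{W_α^⊗}({ρ_{t_0}}_{t_0∈[n−1]}, φ) ≤ ε. -/
open MeasureTheory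
open scoped Classical

namespace ChangePoint

noncomputable section

/-- The `i`-th column (0-based) of the data matrix, with out-of-range guard. -/
def col (p n : ℕ) (X : Fin n → Fin p → ℝ) (i : ℕ) : Fin p → ℝ :=
  if h : i < n then X ⟨i, h⟩ else 0

/-- ℓ₀-"norm": the number of nonzero coordinates. -/
def l0 (p : ℕ) (v : Fin p → ℝ) : ℕ :=
  (Finset.univ.filter fun j : Fin p => v j ≠ 0).card

/-- Squared Euclidean norm on `ℝ^p`. -/
def sqnorm (p : ℕ) (v : Fin p → ℝ) : ℝ := ∑ j, v j ^ 2

/-- The iterated logarithm `log log (8 n)`. -/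
def LL (n : ℕ) : ℝ := Real.log (Real.log (8 * n))

/-- The sub-Weibull class `𝒢_{α,K}` of distributions on `ℝ`:
mean `0`, variance `1` and `𝔼 exp (|W/K|^α) ≤ 2`. -/
def memG (α K : ℝ) (ν : Measure ℝ) : Prop :=
  IsProbabilityMeasure ν ∧ Integrable id ν ∧ (∫ x, x ∂ν) = 0 ∧
    (∫⁻ x, ENNReal.ofReal (x ^ 2) ∂ν) = 1 ∧
    (∫⁻ x, ENNReal.ofReal (Real.exp (|x / K| ^ α)) ∂ν) ≤ 2

/-- The polynomially-tailed class `𝒫_{α,K}` of distributions on `ℝ`: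
mean `0`, variance `1` and `𝔼 |W/K|^α ≤ 1`. -/
def memP (α K : ℝ) (ν : Measure ℝ) : Prop :=
  IsProbabilityMeasure ν ∧ Integrable id ν ∧ (∫ x, x ∂ν) = 0 ∧
    (∫⁻ x, ENNReal.ofReal (x ^ 2) ∂ν) = 1 ∧
    (∫⁻ x, ENNReal.ofReal (|x / K| ^ α) ∂ν) ≤ 1

/-- `P` is the joint law on `ℝ^{p×n}` of `p·n` independent entries with marginal laws `ν t j`
(characterised on measurable rectangles). -/
def IsEntrywiseProduct (p n : ℕ) (P : Measure (Fin n → Fin p → ℝ))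
    (ν : Fin n → Fin p → Measure ℝ) : Prop :=
  IsProbabilityMeasure P ∧
    ∀ s : Fin n → Fin p → Set ℝ, (∀ t j, MeasurableSet (s t j)) →
      P {x | ∀ t j, x t j ∈ s t j} = ∏ t, ∏ j, ν t j (s t j)

/-- The class `𝒢_{α,K}^⊗` of noise distributions. -/
def Gclass (p n : ℕ) (α K : ℝ) : Set (Measure (Fin n → Fin p → ℝ)) :=
  {P | ∃ ν : Fin n → Fin p → Measure ℝ, (∀ t j, memG α K (ν t j)) ∧ IsEntrywiseProduct p n P ν}

/-- The class `𝒫_{α,K}^⊗` of noise distributions. -/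
def Pclass (p n : ℕ) (α K : ℝ) : Set (Measure (Fin n → Fin p → ℝ)) :=
  {P | ∃ ν : Fin n → Fin p → Measure ℝ, (∀ t j, memP α K (ν t j)) ∧ IsEntrywiseProduct p n P ν}

/-- The null parameter space `Θ₀(p,n)`: constant signal. -/
def Theta0 (p n : ℕ) : Set (Fin n → Fin p → ℝ) :=
  {θ | ∃ μ : Fin p → ℝ, ∀ t, θ t = μ}

/-- `Θ^{(t₀)}(p,n,s,ρ)`: a single mean change at (1-based) time `t0` of sparsity `s` and
normalized signal strength at least `ρ`. -/
def ThetaAt (p n t0 s : ℕ) (ρ : ℝ) : Set (Fin n → Fin p → ℝ) :=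
  {θ | ∃ μ₁ μ₂ : Fin p → ℝ,
    (∀ t : Fin n, (t : ℕ) < t0 → θ t = μ₁) ∧
    (∀ t : Fin n, t0 ≤ (t : ℕ) → θ t = μ₂) ∧
    l0 p (fun j => μ₁ j - μ₂ j) ≤ s ∧
    ρ ^ 2 ≤ (t0 : ℝ) * ((n : ℝ) - (t0 : ℝ)) / (n : ℝ) * sqnorm p (fun j => μ₁ j - μ₂ j)}

/-- The single-change-point alternative `Θ(p,n,s,ρ)`. -/
def Theta1 (p n s : ℕ) (ρ : ℝ) : Set (Fin n → Fin p → ℝ) :=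
  ⋃ t0 ∈ Finset.Icc 1 (n - 1), ThetaAt p n t0 s ρ

/-- A (randomized-free) test: a measurable `{0,1}`-valued function of the data. -/
def IsTest (p n : ℕ) (φ : (Fin n → Fin p → ℝ) → ℝ) : Prop :=
  Measurable φ ∧ ∀ x, φ x = 0 ∨ φ x = 1

/-- The worst-case testing error of the test `φ` for null `Θ₀(p,n)` against the
alternative `Θalt`, over the noise class `Q`. -/
def risk (p n : ℕ) (Q : Set (Measure (Fin n → Fin p → ℝ)))
    (Θalt : Set (Fin n → Fin p → ℝ)) (φ : (Fin n → Fin p → ℝ) → ℝ) : ℝ :=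
  (⨆ P ∈ Q, ⨆ θ ∈ Theta0 p n, ∫ E, φ (θ + E) ∂P) +
  (⨆ P ∈ Q, ⨆ θ ∈ Θalt, ∫ E, (1 - φ (θ + E)) ∂P)

/-- The dyadic grid `𝒯 = {1,2,4,…,2^{⌊log₂(n/2)⌋}}`. -/
def Tgrid (n : ℕ) : Finset ℕ :=
  (Finset.range (Nat.log 2 (n / 2) + 1)).image fun k => 2 ^ k

/-- The CUSUM-type statistic `Y_t`. -/
def Yt (p n : ℕ) (X : Fin n → Fin p → ℝ) (t : ℕ) (j : Fin p) : ℝ :=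
  (∑ i ∈ Finset.range t, (col p n X i j - col p n X (n - 1 - i) j)) / Real.sqrt (2 * t)

/-- `A_t = ∑_j (Y_t(j)² − 1)`. -/
def At (p n : ℕ) (X : Fin n → Fin p → ℝ) (t : ℕ) : ℝ :=
  ∑ j, (Yt p n X t j ^ 2 - 1)

/-- The dense sub-Weibull test `φ_{𝒢,dense}` with threshold `r`. -/
def phiGdense (p n : ℕ) (r : ℝ) (X : Fin n → Fin p → ℝ) : ℝ :=
  if ∃ t ∈ Tgrid n, r < At p n X t then 1 else 0

/-- Sample-splitting statistic `Y_{t,1}` (odd-indexed observations). -/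
def Yt1 (p n : ℕ) (X : Fin n → Fin p → ℝ) (t : ℕ) (j : Fin p) : ℝ :=
  (∑ i ∈ Finset.range (t / 2), (col p n X (2 * i) j - col p n X (n - 1 - 2 * i) j)) /
    Real.sqrt t

/-- Sample-splitting statistic `Y_{t,2}` (even-indexed observations). -/
def Yt2 (p n : ℕ) (X : Fin n → Fin p → ℝ) (t : ℕ) (j : Fin p) : ℝ :=
  (∑ i ∈ Finset.range (t / 2), (col p n X (2 * i + 1) j - col p n X (n - 2 - 2 * i) j)) /
    Real.sqrt t

/-- `Y_1 = (X_1 − X_n)/√2`. -/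
def Y1 (p n : ℕ) (X : Fin n → Fin p → ℝ) (j : Fin p) : ℝ :=
  (col p n X 0 j - col p n X (n - 1) j) / Real.sqrt 2

/-- The hard-thresholded statistic `A_{t,a}`. -/
def Ata (p n : ℕ) (X : Fin n → Fin p → ℝ) (t : ℕ) (a : ℝ) : ℝ :=
  if t = 1 then ∑ j, (Y1 p n X j ^ 2 - 1) * (if a ≤ |Y1 p n X j| then 1 else 0)
  else ∑ j, (Yt1 p n X t j ^ 2 - 1) * (if a ≤ |Yt2 p n X t j| then 1 else 0)

/-- The sparse sub-Weibull test `φ_{𝒢,sparse}` with threshold parameters `a, r, r₁`. -/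
def phiGsparse (p n : ℕ) (a r r₁ : ℝ) (X : Fin n → Fin p → ℝ) : ℝ :=
  if (∃ t ∈ Tgrid n, t ≠ 1 ∧ r < Ata p n X t a) ∨ r₁ < Ata p n X 1 a then 1 else 0

/-- The median of a list of reals: its `⌈m/2⌉`-th smallest element. -/
def median (l : List ℝ) : ℝ :=
  (l.insertionSort (· ≤ ·)).getD ((l.length + 1) / 2 - 1) 0

/-- `Z_i = (X_i − X_{n+1−i})/√2` (0-based index `i`). -/
def Zb (p n : ℕ) (X : Fin n → Fin p → ℝ) (i : ℕ) (j : Fin p) : ℝ :=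
  (col p n X i j - col p n X (n - 1 - i) j) / Real.sqrt 2

/-- Mean of the `g`-th (0-based) of `G` consecutive equal-size groups of `Z_1,…,Z_t`. -/
def groupMean (p n : ℕ) (X : Fin n → Fin p → ℝ) (t G g : ℕ) (j : Fin p) : ℝ :=
  (∑ i ∈ Finset.range (t / G), Zb p n X (g * (t / G) + i) j) / ((t / G : ℕ) : ℝ)

/-- The median-of-means statistic `A_t^{MoM}` with `G` groups. -/
def AMoM (p n : ℕ) (X : Fin n → Fin p → ℝ) (t G : ℕ) : ℝ :=
  (t : ℝ) * median (List.ofFn fun g : Fin G =>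
    ∑ j, (groupMean p n X t G (g : ℕ) j ^ 2 - (G : ℝ) / (t : ℝ)))

/-- `Δ = 2^{3+⌈log₂ log log (8n)⌉}`. -/
def DeltaDense (n : ℕ) : ℕ := 2 ^ (3 + (Int.ceil (Real.logb 2 (LL n))).toNat)

/-- The dense median-of-means test `φ_{𝒫,dense}`. -/
def phiPdense (p n : ℕ) (α C₁ : ℝ) (X : Fin n → Fin p → ℝ) : ℝ :=
  if ∃ t ∈ Tgrid n,
      1 < AMoM p n X t (min t (DeltaDense n)) /
        (C₁ * (p : ℝ) ^ max ((1 : ℝ) / 2) (2 / α) * ((min t (DeltaDense n) : ℕ) : ℝ))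
  then 1 else 0

/-- `Δ = 2^{4+⌈log₂ log log (8n)⌉}`. -/
def DeltaSparse (n : ℕ) : ℕ := 2 ^ (4 + (Int.ceil (Real.logb 2 (LL n))).toNat)

/-- Mean of the `g`-th (0-based) of `G` consecutive equal-size groups of the odd-indexed
`Z_1, Z_3, …, Z_{t−1}`. -/
def groupMeanOdd (p n : ℕ) (X : Fin n → Fin p → ℝ) (t G g : ℕ) (j : Fin p) : ℝ :=
  (∑ i ∈ Finset.range (t / (2 * G)), Zb p n X (2 * (g * (t / (2 * G)) + i)) j) /
    ((t / (2 * G) : ℕ) : ℝ)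

/-- The hard-thresholded median-of-means statistic `A_{t,a}^{MoM}` with `G` groups. -/
def AMoMa (p n : ℕ) (X : Fin n → Fin p → ℝ) (t G : ℕ) (a : ℝ) : ℝ :=
  if t = 1 then ∑ j, (Zb p n X 0 j ^ 2 - 1) * (if a ≤ |Zb p n X 0 j| then 1 else 0)
  else ((t : ℝ) / 2) * median (List.ofFn fun g : Fin G =>
    ∑ j, (groupMeanOdd p n X t G (g : ℕ) j ^ 2 - 2 * (G : ℝ) / (t : ℝ)) *
      (if a ≤ |Yt2 p n X t j| then 1 else 0))

/-- The sparse median-of-means test `φ_{𝒫,sparse}^{MoM}`. -/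
def phiPsparseMoM (p n s : ℕ) (α C₁ C₂ : ℝ) (X : Fin n → Fin p → ℝ) : ℝ :=
  if ∃ t ∈ Tgrid n,
      1 < AMoMa p n X t (min t (DeltaSparse n) / 2)
            (C₁ * (((p : ℝ) / (s : ℝ)) ^ ((1 : ℝ) / α) +
              ((s : ℝ) ^ (-(1 : ℝ) / 2)) * Real.sqrt (LL n))) /
          (C₂ * (if t = 1 then (s : ℝ) * ((p : ℝ) / (s : ℝ)) ^ ((2 : ℝ) / α)
                 else Real.sqrt (s : ℝ) * ((min t (DeltaSparse n) / 2 : ℕ) : ℝ)))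
  then 1 else 0

/-- Condition RSM for `(α, K)` with constants `C₁, C₂`: statistical guarantee for a family
of (measurable) robust sparse mean estimators. -/
def CondRSM (p s : ℕ) (α K C₁ C₂ : ℝ)
    (est : (m : ℕ) → (Fin m → Fin p → ℝ) → ℝ → Fin p → ℝ) : Prop :=
  (∀ m : ℕ, Measurable fun Wη : (Fin m → Fin p → ℝ) × ℝ => est m Wη.1 Wη.2) ∧
  ∀ (m : ℕ) (μW : Fin p → ℝ) (ν : Fin m → Measure (Fin p → ℝ))
    (P : Measure (Fin m → Fin p → ℝ)) (η : ℝ),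
    0 < η → η < 1 → l0 p μW ≤ s →
    (∀ i, IsProbabilityMeasure (ν i)) →
    (∀ i j, Integrable (fun w => w j) (ν i) ∧ (∫ w, w j ∂ν i) = μW j) →
    (∀ i j k, Integrable (fun w => (w j - μW j) * (w k - μW k)) (ν i) ∧
      (∫ w, (w j - μW j) * (w k - μW k) ∂ν i) = if j = k then 1 else 0) →
    (∀ i j, (∫⁻ w, ENNReal.ofReal (|w j - μW j| ^ α) ∂ν i) ≤
      ENNReal.ofReal ((Real.sqrt 2 * K) ^ α)) →
    IsProbabilityMeasure P →
    (∀ S : Fin m → Set (Fin p → ℝ), (∀ i, MeasurableSet (S i)) →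
      P {W | ∀ i, W i ∈ S i} = ∏ i, ν i (S i)) →
    C₁ * ((s : ℝ) * Real.log (Real.exp 1 * (p : ℝ) / (s : ℝ)) + Real.log (1 / η)) ≤ (m : ℝ) →
    ENNReal.ofReal (1 - η) ≤
      P {W | Real.sqrt (sqnorm p fun j => est m W η j - μW j) ≤
        Real.sqrt C₂ * (Real.sqrt ((s : ℝ) * Real.log (Real.exp 1 * (p : ℝ) / (s : ℝ)) / (m : ℝ)) +
          Real.sqrt (Real.log (1 / η) / (m : ℝ)))}

/-- `Δ̃₁ = C₅ (s log(ep/s) + log(16/ε))`. -/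
def rsmDelta1 (p s : ℕ) (ε C₅ : ℝ) : ℝ :=
  C₅ * ((s : ℝ) * Real.log (Real.exp 1 * (p : ℝ) / (s : ℝ)) + Real.log (16 / ε))

/-- `Δ̃₂ = C₅ (s log(ep/s) + log(16 log(2n)/ε))`. -/
def rsmDelta2 (p s n : ℕ) (ε C₅ : ℝ) : ℝ :=
  C₅ * ((s : ℝ) * Real.log (Real.exp 1 * (p : ℝ) / (s : ℝ)) +
    Real.log (16 * Real.log (2 * (n : ℝ)) / ε))

/-- `a = C₃ ((p/s)^{1/α} + s^{−1/2} log^{1/2}(log Δ̃₁))`. -/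
def rsmA (p s : ℕ) (α ε C₃ C₅ : ℝ) : ℝ :=
  C₃ * (((p : ℝ) / (s : ℝ)) ^ ((1 : ℝ) / α) +
    ((s : ℝ) ^ (-(1 : ℝ) / 2)) * Real.sqrt (Real.log (Real.log (rsmDelta1 p s ε C₅))))

/-- The sparse test `φ^{RSM}_{𝒫,sparse}` built from a robust sparse mean estimator `est`. -/
def phiRSM (p n s : ℕ) (est : (m : ℕ) → (Fin m → Fin p → ℝ) → ℝ → Fin p → ℝ)
    (α ε C₃ C₄ C₅ C₆ : ℝ) (X : Fin n → Fin p → ℝ) : ℝ :=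
  if (∃ t ∈ Tgrid n, (t : ℝ) ≤ rsmDelta1 p s ε C₅ ∧
        1 < Ata p n X t (rsmA p s α ε C₃ C₅) /
          (C₄ * (if t = 1 then (s : ℝ) * ((p : ℝ) / (s : ℝ)) ^ ((2 : ℝ) / α)
                 else Real.sqrt ((s : ℝ) * Real.log (rsmDelta1 p s ε C₅))))) ∨
     (∃ t ∈ Tgrid n, rsmDelta1 p s ε C₅ < (t : ℝ) ∧
        1 < (t : ℝ) * sqnorm p (est t (fun i : Fin t => fun j => Zb p n X (i : ℕ) j)
              (Real.exp ((s : ℝ) * Real.log (Real.exp 1 * (p : ℝ) / (s : ℝ)) -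
                min (t : ℝ) (rsmDelta2 p s n ε C₅) / C₅))) /
          (C₆ * min (t : ℝ) (rsmDelta2 p s n ε C₅)))
  then 1 else 0

/-- The multiple-change-point alternative `Θ_multi(p,n,ρ)`. -/
def ThetaMulti (p n : ℕ) (ρ : ℝ) : Set (Fin n → Fin p → ℝ) :=
  {θ | ∃ k : ℕ, 1 ≤ k ∧ ∃ τ : ℕ → ℕ, ∃ μ : ℕ → Fin p → ℝ,
    τ 0 = 0 ∧ τ (k + 1) = n ∧ (∀ i ≤ k, τ i < τ (i + 1)) ∧
    (∀ i, 1 ≤ i → i ≤ k + 1 →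
      ∀ t : Fin n, τ (i - 1) ≤ (t : ℕ) → (t : ℕ) < τ i → θ t = μ i) ∧
    ∃ i, 1 ≤ i ∧ i ≤ k ∧
      4 * Real.log (n : ℝ) ≤ ((min (τ i - τ (i - 1)) (τ (i + 1) - τ i) : ℕ) : ℝ) ∧
      ρ ^ 2 ≤ sqnorm p (fun j => μ (i + 1) j - μ i j) *
        ((min (τ i - τ (i - 1)) (τ (i + 1) - τ i) : ℕ) : ℝ)}

/-- Membership in the temporal-dependence class `𝒫_Temp`: independent rows, entrywise
`𝒫_{α,K}` marginals, and exponentially decaying interlaced α-mixing coefficients. -/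
def memPTemp (p n : ℕ) (α K c₁ c₂ : ℝ) (P : Measure (Fin n → Fin p → ℝ)) : Prop :=
  IsProbabilityMeasure P ∧
  (∀ s : Fin p → Set (Fin n → ℝ), (∀ j, MeasurableSet (s j)) →
    P {x | ∀ j, (fun t => x t j) ∈ s j} = ∏ j, P {x | (fun t => x t j) ∈ s j}) ∧
  (∀ t j, memP α K (P.map fun x => x t j)) ∧
  (∀ i : ℕ, 1 ≤ i → i ≤ n - 1 →
    ∀ S T : Set (Fin n),
      (∀ s' ∈ S, ∀ t' ∈ T, (i : ℤ) ≤ |((s' : ℕ) : ℤ) - ((t' : ℕ) : ℤ)|) →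
      ∀ A B : Set (Fin n → Fin p → ℝ),
        MeasurableSet[MeasurableSpace.comap (fun x (t : S) => x t.1) inferInstance] A →
        MeasurableSet[MeasurableSpace.comap (fun x (t : T) => x t.1) inferInstance] B →
        |(P (A ∩ B)).toReal - (P A).toReal * (P B).toReal| ≤ c₁ * Real.exp (-c₂ * (i : ℝ)))

/-- The class `𝒲_α` of distributions on `ℝ^p`: centered with `𝔼|⟨W,v⟩|^α ≤ 1` for
every unit vector `v`. -/
def memW (p : ℕ) (α : ℝ) (ν : Measure (Fin p → ℝ)) : Prop :=
  IsProbabilityMeasure ν ∧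
  (∀ j, Integrable (fun w => w j) ν ∧ (∫ w, w j ∂ν) = 0) ∧
  ∀ v : Fin p → ℝ, sqnorm p v = 1 →
    (∫⁻ w, ENNReal.ofReal (|∑ j, w j * v j| ^ α) ∂ν) ≤ 1

/-- The class `𝒲_α^⊗`: independent columns with distributions in `𝒲_α`. -/
def Wclass (p n : ℕ) (α : ℝ) : Set (Measure (Fin n → Fin p → ℝ)) :=
  {P | ∃ ν : Fin n → Measure (Fin p → ℝ), (∀ t, memW p α (ν t)) ∧
    IsProbabilityMeasure P ∧
    ∀ s : Fin n → Set (Fin p → ℝ), (∀ t, MeasurableSet (s t)) →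
      P {x | ∀ t, x t ∈ s t} = ∏ t, ν t (s t)}

/-- The alternative `⋃_{t₀=1}^{n−1} Θ(p,n,ρ_{t₀})` for a location-dependent signal
strength sequence `ρ`. -/
def ThetaSeq (p n : ℕ) (ρ : ℕ → ℝ) : Set (Fin n → Fin p → ℝ) :=
  ⋃ t0 ∈ Finset.Icc 1 (n - 1),
    {θ | ∃ μ₁ μ₂ : Fin p → ℝ,
      (∀ t : Fin n, (t : ℕ) < t0 → θ t = μ₁) ∧
      (∀ t : Fin n, t0 ≤ (t : ℕ) → θ t = μ₂) ∧
      (ρ t0) ^ 2 ≤ sqnorm p (fun j => μ₁ j - μ₂ j)}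

/-- The boundary-restricted alternative `Θ_res(p,n,s,ρ)`. -/
def ThetaRes (p n s : ℕ) (ρ tres : ℝ) : Set (Fin n → Fin p → ℝ) :=
  {θ | ∃ t0 : ℕ, tres + 1 ≤ (t0 : ℝ) ∧ (t0 : ℝ) ≤ (n : ℝ) - tres ∧ θ ∈ ThetaAt p n t0 s ρ}

/-- `t^res = 32 (log (e² p / s) + s^{−1} log log (8n))`. -/
def tRes (p n s : ℕ) : ℝ :=
  32 * (Real.log (Real.exp 1 ^ 2 * (p : ℝ) / (s : ℝ)) + LL n / (s : ℝ))

end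

/-- Truncation of a real number to the interval `[-L, L]`. -/
noncomputable def clip (L x : ℝ) : ℝ := max (-L) (min L x)

lemma clip_mono (L : ℝ) : Monotone (clip L) := fun _ _ h =>
  max_le_max le_rfl (min_le_min le_rfl h)

lemma measurable_clip (L : ℝ) : Measurable (clip L) := (clip_mono L).measurable

lemma clip_neg {L : ℝ} (hL : 0 ≤ L) (x : ℝ) : clip L (-x) = -clip L x := by
  unfold clip
  rcases max_cases (-L) (min L (-x)) with h | h <;> rcases min_cases L (-x) with h' | h' <;>
  rcases max_cases (-L) (min L x) with h'' | h'' <;> rcases min_cases L x with h3 | h3 <;>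
  linarith

lemma clip_le {L : ℝ} (hL : 0 ≤ L) (x : ℝ) : clip L x ≤ L :=
  max_le (by linarith) (min_le_left _ _)

lemma neg_le_clip (L x : ℝ) : -L ≤ clip L x := le_max_left _ _

lemma exp_clip_le {α L : ℝ} (hα1 : 1 ≤ α) (hα2 : α ≤ 2) (hL : 1 ≤ L) (x : ℝ) :
    Real.exp (clip L x) ≤ 1 + x + Real.exp L * |x| ^ α := by
  have h0 := Real.rpow_nonneg (abs_nonneg x) α
  have hE : 1 ≤ Real.exp L := Real.one_le_exp (by linarith)
  have hmul : |x| ^ α ≤ Real.exp L * |x| ^ α := le_mul_of_one_le_left h0 hE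
  rcases le_or_gt |x| 1 with h | h
  · have hx := abs_le.1 h
    have hc : clip L x = x := by
      unfold clip
      rw [min_eq_right (by linarith), max_eq_right (by linarith)]
    have h1 := Real.abs_exp_sub_one_sub_id_le h
    have h2 : x ^ 2 ≤ |x| ^ α := by
      rw [← sq_abs, ← Real.rpow_natCast]
      exact Real.rpow_le_rpow_of_exponent_ge_of_imp (abs_nonneg x) h (by exact_mod_cast hα2)
        (fun _ h => by norm_num at h)
    rw [hc]
    linarith [(abs_le.1 h1).2]
  · have h1 : 1 ≤ |x| ^ α := Real.one_le_rpow h.le (by linarith)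
    rcases lt_abs.1 h with hx | hx
    · have : Real.exp (clip L x) ≤ Real.exp L := Real.exp_le_exp.2 (clip_le (by linarith) x)
      nlinarith
    · have : Real.exp (clip L x) ≤ 1 := by
        rw [Real.exp_le_one_iff]
        exact max_le (by linarith) ((min_le_right _ _).trans (by linarith))
      have h3 := Real.self_le_rpow_of_one_le h.le hα1
      have := neg_abs_le x
      linarith

lemma exp_neg_clip_le {α L : ℝ} (hα1 : 1 ≤ α) (hα2 : α ≤ 2) (hL : 1 ≤ L) (x : ℝ) :
    Real.exp (-clip L x) ≤ 1 - x + Real.exp L * |x| ^ α := by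
  have := exp_clip_le hα1 hα2 hL (-x)
  rw [clip_neg (by linarith), abs_neg] at this
  linarith

lemma abs_add_rpow_le {α : ℝ} (hα1 : 1 ≤ α) (hα2 : α ≤ 2) (a b : ℝ) :
    |a + b| ^ α ≤ 2 * (|a| ^ α + |b| ^ α) := by
  have h1 : |a + b| ^ α ≤ (|a| + |b|) ^ α :=
    Real.rpow_le_rpow (abs_nonneg _) (abs_add_le a b) (by linarith)
  have h2 := NNReal.rpow_add_le_mul_rpow_add_rpow ⟨|a|, abs_nonneg a⟩ ⟨|b|, abs_nonneg b⟩ hα1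
  have h3 : (|a| + |b|) ^ α ≤ 2 ^ (α - 1) * (|a| ^ α + |b| ^ α) := by exact_mod_cast h2
  have h4 : (2 : ℝ) ^ (α - 1) ≤ 2 := by
    have := Real.rpow_le_rpow_of_exponent_le (x := 2) (by norm_num) (show α - 1 ≤ 1 by linarith)
    simpa using this
  have h5 : 0 ≤ |a| ^ α + |b| ^ α := by positivity
  nlinarith

lemma exp_neg_clip_add_le_of_large {α L y v : ℝ} (hα1 : 1 ≤ α) (hL : 1 ≤ L)
    (hy : 2 * L ≤ y) :
    Real.exp (-clip L (y + v)) ≤ Real.exp (-L) + Real.exp L * |v| ^ α := by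
  have h0 := Real.rpow_nonneg (abs_nonneg v) α
  rcases le_or_gt |v| L with h | h
  · have := (abs_le.1 h).1
    have hc : clip L (y + v) = L := by
      unfold clip
      rw [min_eq_left (by linarith), max_eq_right (by linarith)]
    rw [hc]
    have := Real.exp_pos L
    nlinarith
  · have h1 : 1 ≤ |v| ^ α := Real.one_le_rpow (by linarith) (by linarith)
    have h2 : Real.exp (-clip L (y + v)) ≤ Real.exp L :=
      Real.exp_le_exp.2 (by linarith [neg_le_clip L (y + v)])
    have := Real.exp_pos L
    have := Real.exp_pos (-L)
    nlinarith

section Moments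

variable {Ω : Type*} [MeasurableSpace Ω] {P : Measure Ω} {V : Ω → ℝ} {α L q : ℝ}

lemma integrable_abs_rpow (hV : Integrable V P)
    (hq : ∫⁻ ω, ENNReal.ofReal (|V ω| ^ α) ∂P ≤ ENNReal.ofReal q) :
    Integrable (fun ω => |V ω| ^ α) P := by
  refine ⟨(hV.aestronglyMeasurable.aemeasurable.abs.pow_const α).aestronglyMeasurable, ?_⟩
  rw [hasFiniteIntegral_iff_ofReal (ae_of_all _ fun ω => by positivity)]
  exact hq.trans_lt ENNReal.ofReal_lt_top

lemma integral_abs_rpow_le (hV : Integrable V P) (hq0 : 0 ≤ q)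
    (hq : ∫⁻ ω, ENNReal.ofReal (|V ω| ^ α) ∂P ≤ ENNReal.ofReal q) :
    ∫ ω, |V ω| ^ α ∂P ≤ q := by
  rw [integral_eq_lintegral_of_nonneg_ae (ae_of_all _ fun ω => by positivity)
    (integrable_abs_rpow hV hq).aestronglyMeasurable]
  exact ENNReal.toReal_le_of_le_ofReal hq0 hq

lemma lintegral_ofReal_le_of_le {f g : Ω → ℝ} {c : ℝ} (hg : Integrable g P)
    (hf : ∀ ω, 0 ≤ f ω) (hfg : ∀ ω, f ω ≤ g ω) (hc : ∫ ω, g ω ∂P ≤ c) :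
    ∫⁻ ω, ENNReal.ofReal (f ω) ∂P ≤ ENNReal.ofReal c := by
  refine (lintegral_mono fun ω => ENNReal.ofReal_le_ofReal (hfg ω)).trans ?_
  rw [← ofReal_integral_eq_lintegral_ofReal hg (ae_of_all _ fun ω => (hf ω).trans (hfg ω))]
  exact ENNReal.ofReal_le_ofReal hc

variable [IsProbabilityMeasure P]

lemma lintegral_exp_clip_le (hα1 : 1 ≤ α) (hα2 : α ≤ 2) (hL : 1 ≤ L) (hq0 : 0 ≤ q)
    (hV : Integrable V P) (hV0 : ∫ ω, V ω ∂P = 0)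
    (hq : ∫⁻ ω, ENNReal.ofReal (|V ω| ^ α) ∂P ≤ ENNReal.ofReal q) :
    ∫⁻ ω, ENNReal.ofReal (Real.exp (clip L (V ω))) ∂P
      ≤ ENNReal.ofReal (1 + Real.exp L * q) := by
  have hI := integrable_abs_rpow hV hq
  have hI2 := integral_abs_rpow_le hV hq0 hq
  refine lintegral_ofReal_le_of_le (g := fun ω => 1 + V ω + Real.exp L * |V ω| ^ α)
    (by fun_prop) (fun ω => (Real.exp_pos _).le) (fun ω => exp_clip_le hα1 hα2 hL _) ?_
  rw [integral_add (by fun_prop) (by fun_prop), integral_add (by fun_prop) hV, hV0,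
    integral_const_mul]
  simp only [integral_const, probReal_univ, smul_eq_mul]
  have := Real.exp_pos L
  nlinarith

lemma lintegral_exp_neg_clip_add_le_of_small {κ y : ℝ} (hα1 : 1 ≤ α) (hα2 : α ≤ 2)
    (hL : 1 ≤ L) (hq0 : 0 ≤ q) (hκ : 0 ≤ κ) (hy : κ ≤ y)
    (hV : Integrable V P) (hV0 : ∫ ω, V ω ∂P = 0)
    (hq : ∫⁻ ω, ENNReal.ofReal (|V ω| ^ α) ∂P ≤ ENNReal.ofReal q) :
    ∫⁻ ω, ENNReal.ofReal (Real.exp (-clip L (y + V ω))) ∂P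
      ≤ ENNReal.ofReal (1 - κ + 2 * Real.exp L * (κ ^ α + q)) := by
  have hI := integrable_abs_rpow hV hq
  have hI2 := integral_abs_rpow_le hV hq0 hq
  have hE := Real.exp_pos L
  refine lintegral_ofReal_le_of_le
    (g := fun ω => (1 - κ + 2 * Real.exp L * κ ^ α) - V ω + (2 * Real.exp L) * |V ω| ^ α)
    (by fun_prop) (fun ω => (Real.exp_pos _).le) (fun ω => ?_) ?_
  · have h1 : Real.exp (-clip L (y + V ω)) ≤ Real.exp (-clip L (κ + V ω)) :=
      Real.exp_le_exp.2 (neg_le_neg (clip_mono L (by linarith)))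
    have h2 := exp_neg_clip_le hα1 hα2 hL (κ + V ω)
    have h3 := abs_add_rpow_le hα1 hα2 κ (V ω)
    rw [abs_of_nonneg hκ] at h3
    nlinarith
  · rw [integral_add (by fun_prop) (by fun_prop), integral_sub (by fun_prop) hV, hV0,
      integral_const_mul]
    simp only [integral_const, probReal_univ, smul_eq_mul]
    nlinarith

lemma lintegral_exp_neg_clip_add_le_of_large {y : ℝ} (hα1 : 1 ≤ α)
    (hL : 1 ≤ L) (hq0 : 0 ≤ q) (hy : 2 * L ≤ y) (hV : Integrable V P)
    (hq : ∫⁻ ω, ENNReal.ofReal (|V ω| ^ α) ∂P ≤ ENNReal.ofReal q) :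
    ∫⁻ ω, ENNReal.ofReal (Real.exp (-clip L (y + V ω))) ∂P
      ≤ ENNReal.ofReal (Real.exp (-L) + Real.exp L * q) := by
  have hI := integrable_abs_rpow hV hq
  have hI2 := integral_abs_rpow_le hV hq0 hq
  have hE := Real.exp_pos L
  refine lintegral_ofReal_le_of_le
    (g := fun ω => Real.exp (-L) + Real.exp L * |V ω| ^ α)
    (by fun_prop) (fun ω => (Real.exp_pos _).le)
    (fun ω => exp_neg_clip_add_le_of_large hα1 hL hy) ?_
  rw [integral_add (by fun_prop) (by fun_prop), integral_const_mul]
  simp only [integral_const, probReal_univ, smul_eq_mul]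
  nlinarith

end Moments

/-- Admissible parameters of the truncated score: `L` is the truncation level, `q` bounds the
`α`-th moment of the noise, `y` is the detectable signal, and `b`, `f` bound the exponential
moments of the score under the null and of its negative under the alternative. -/
structure ScoreParams (α L q y b f : ℝ) : Prop where
  one_le_L : 1 ≤ L
  q_pos : 0 < q
  y_pos : 0 < y
  b_pos : 0 < b
  f_pos : 0 < f
  null_le : 1 + Real.exp L * q ≤ b
  alt_le : (2 * L ≤ y ∧ Real.exp (-L) + Real.exp L * q ≤ f) ∨
    1 - y + 2 * Real.exp L * (y ^ α + q) ≤ f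

lemma exists_scoreParams {α : ℝ} (hα1 : 1 < α) {h₀ : ℝ} (hh₀ : 0 ≤ h₀) :
    ∃ C : ℝ, 1 ≤ C ∧ ∀ h : ℝ, 0 < h → h ≤ h₀ → ∃ L q y b f : ℝ,
      ScoreParams α L q y b f ∧ b * f ≤ Real.exp (-h) ∧
      y * (4 / q) ^ (1 / α) ≤ C * h ^ ((α - 1) / α) := by
  set β := (α - 1) / α with hβ
  have hα0 : 0 < α := by linarith
  have hβ0 : 0 < β := div_pos (by linarith) hα0
  have hβ1 : β ≤ 1 := by rw [hβ, div_le_one hα0]; linarith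
  set κ₀ : ℝ := (1 / 24 : ℝ) ^ (1 / (α - 1)) with hκ₀
  have hκ₀pos : 0 < κ₀ := by positivity
  set L₀ := 2 + h₀ with hL₀
  set K := 2 * L₀ * (4 / Real.exp (-2 * L₀)) ^ (1 / α) with hK
  have hKpos : 0 < K := by positivity
  have he3 : Real.exp 1 ≤ 3 := by linarith [Real.exp_one_lt_d9]
  refine ⟨288 + K / (κ₀ / 2) ^ β, by linarith [show 0 ≤ K / (κ₀ / 2) ^ β by positivity],
    fun h hh hhh => ?_⟩
  have hhβ : 0 < h ^ β := by positivity
  rcases le_or_gt (2 * h) κ₀ with hs | hs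
  · set κ := 2 * h with hκ
    have hκpos : 0 < κ := by positivity
    have h1 : κ ^ (α - 1) ≤ 1 / 24 := by
      refine (Real.rpow_le_rpow hκpos.le hs (by linarith)).trans_eq ?_
      rw [hκ₀, ← Real.rpow_mul (by norm_num), one_div_mul_cancel (by linarith), Real.rpow_one]
    have h2 : κ ^ α ≤ κ / 24 := by
      have : κ ^ α = κ * κ ^ (α - 1) := by
        rw [← Real.rpow_one_add' hκpos.le (by linarith)]; congr 1; ring
      rw [this]; nlinarith
    refine ⟨1, κ / 36, κ, Real.exp (κ / 12), Real.exp (-(7 * κ / 12)), ⟨le_rfl, by positivity,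
      hκpos, Real.exp_pos _, Real.exp_pos _, ?_, Or.inr ?_⟩, ?_, ?_⟩
    · have := Real.add_one_le_exp (κ / 12)
      nlinarith
    · have h3 := Real.add_one_le_exp (-(7 * κ / 12))
      have h4 : 0 ≤ κ ^ α := by positivity
      nlinarith
    · rw [← Real.exp_add]
      exact Real.exp_le_exp.2 (by rw [hκ]; linarith)
    · have h5 : κ * (4 / (κ / 36)) ^ (1 / α) = 144 ^ (1 / α) * κ ^ β := by
        rw [show 4 / (κ / 36) = 144 / κ by field_simp; norm_num,
          Real.div_rpow (by norm_num) hκpos.le, hβ,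
          show (α - 1) / α = 1 - 1 / α by field_simp, Real.rpow_sub hκpos, Real.rpow_one]
        ring
      have h6 : (144 : ℝ) ^ (1 / α) ≤ 144 := by
        have := Real.rpow_le_rpow_of_exponent_le (x := 144) (by norm_num)
          (show 1 / α ≤ 1 by rw [div_le_one hα0]; linarith)
        simpa using this
      have h7 : κ ^ β ≤ 2 * h ^ β := by
        rw [hκ, Real.mul_rpow (by norm_num) hh.le]
        have := Real.rpow_le_rpow_of_exponent_le (x := 2) (by norm_num) hβ1
        rw [Real.rpow_one] at this
        gcongr
      have h8 : 0 ≤ K / (κ₀ / 2) ^ β * h ^ β := by positivity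
      rw [h5]
      have h9 : 0 ≤ κ ^ β := by positivity
      nlinarith
  · have hL1 : 1 ≤ L₀ := by linarith
    have hE := Real.exp_pos L₀
    have hEE : Real.exp L₀ * Real.exp (-2 * L₀) = Real.exp (-L₀) := by
      rw [← Real.exp_add]; congr 1; ring
    refine ⟨L₀, Real.exp (-2 * L₀), 2 * L₀, 2, 2 * Real.exp (-L₀), ⟨hL1, Real.exp_pos _,
      by positivity, by norm_num, by positivity, ?_, Or.inl ⟨le_rfl, ?_⟩⟩, ?_, ?_⟩
    · rw [hEE]
      have : Real.exp (-L₀) ≤ 1 := Real.exp_le_one_iff.2 (by linarith)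
      linarith
    · rw [hEE]; linarith
    · have h4 : (4 : ℝ) ≤ Real.exp 2 := by
        have := Real.exp_one_gt_d9
        rw [show (2 : ℝ) = 1 + 1 by norm_num, Real.exp_add]
        nlinarith
      have h5 : Real.exp (-L₀) = Real.exp (-2) * Real.exp (-h₀) := by
        rw [← Real.exp_add, hL₀]; congr 1; ring
      have h6 : Real.exp 2 * Real.exp (-2) = 1 := by rw [← Real.exp_add]; simp
      have h7 : Real.exp (-h₀) ≤ Real.exp (-h) := Real.exp_le_exp.2 (by linarith)
      have h8 : 4 * Real.exp (-2) ≤ 1 := by nlinarith [Real.exp_pos (-2)]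
      rw [h5]
      nlinarith [Real.exp_pos (-h₀)]
    · change K ≤ _
      have h9 : (κ₀ / 2) ^ β ≤ h ^ β :=
        Real.rpow_le_rpow (by positivity) (by linarith) hβ0.le
      have h10 : 0 < (κ₀ / 2) ^ β := by positivity
      calc K = K / (κ₀ / 2) ^ β * (κ₀ / 2) ^ β := by field_simp
        _ ≤ K / (κ₀ / 2) ^ β * h ^ β := by gcongr
        _ ≤ _ := by nlinarith

section

open ProbabilityTheory

section Gaussian

/-- The standard Gaussian distribution on `ℝ^p`. -/
noncomputable abbrev stdNormal (p : ℕ) : Measure (Fin p → ℝ) :=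
  Measure.pi fun _ => gaussianReal 0 1

lemma map_linear_stdNormal {p : ℕ} {u : Fin p → ℝ} (hu : sqnorm p u = 1) :
    (stdNormal p).map (fun g => ∑ j, g j * u j) = gaussianReal 0 1 := by
  have hm : Measurable fun g : Fin p → ℝ => ∑ j, g j * u j := by fun_prop
  have := Measure.isProbabilityMeasure_map (μ := stdNormal p) hm.aemeasurable
  apply Measure.ext_of_charFun
  ext t
  rw [charFun_apply_real, integral_map hm.aemeasurable (by fun_prop)]
  have h1 : ∀ g : Fin p → ℝ, Complex.exp (t * ((∑ j, g j * u j : ℝ) : ℂ) * Complex.I) =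
      ∏ j, Complex.exp (((t * u j : ℝ) : ℂ) * (g j : ℂ) * Complex.I) := by
    intro g
    rw [← Complex.exp_sum]
    congr 1
    push_cast
    rw [Finset.mul_sum, Finset.sum_mul]
    exact Finset.sum_congr rfl fun j _ => by ring
  simp_rw [h1]
  rw [integral_fintype_prod_eq_prod
    (f := fun j (x : ℝ) => Complex.exp (((t * u j : ℝ) : ℂ) * (x : ℂ) * Complex.I))]
  simp_rw [← charFun_apply_real, charFun_gaussianReal]
  rw [← Complex.exp_sum]
  congr 1
  have h2 : ∑ j, u j ^ 2 = 1 := hu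
  have h3 : ∑ j, (u j : ℂ) ^ 2 = 1 := by exact_mod_cast h2
  have h4 : ∀ j, ((t * u j : ℝ) : ℂ) * ((0 : ℝ) : ℂ) * Complex.I -
      (((1 : NNReal) : ℝ) : ℂ) * ((t * u j : ℝ) : ℂ) ^ 2 / 2 = (-(t : ℂ) ^ 2 / 2) * (u j : ℂ) ^ 2 := by
    intro j; push_cast; ring
  have h5 : ∑ j, (((t * u j : ℝ) : ℂ) * ((0 : ℝ) : ℂ) * Complex.I -
      (((1 : NNReal) : ℝ) : ℂ) * ((t * u j : ℝ) : ℂ) ^ 2 / 2) =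
        (t : ℂ) * ((0 : ℝ) : ℂ) * Complex.I - (((1 : NNReal) : ℝ) : ℂ) * (t : ℂ) ^ 2 / 2 := by
    simp_rw [h4, ← Finset.mul_sum, h3]
    push_cast; ring
  simpa using h5

lemma gaussianReal_Ici_ge {m : ℝ} (hm : 1 ≤ m) :
    Real.exp (-3 * m) ≤ (gaussianReal 0 1).real (Set.Ici (Real.sqrt m)) := by
  set a := Real.sqrt m with ha
  have ha0 : 0 ≤ a := Real.sqrt_nonneg m
  have ha2 : a ^ 2 = m := Real.sq_sqrt (by linarith)
  have h1 : (gaussianReal 0 1).real (Set.Icc a (a + 1)) ≤ (gaussianReal 0 1).real (Set.Ici a) :=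
    measureReal_mono Set.Icc_subset_Ici_self
  refine le_trans ?_ h1
  have h2 : (gaussianReal 0 1).real (Set.Icc a (a + 1)) =
      ∫ x in Set.Icc a (a + 1), gaussianPDFReal 0 1 x := by
    rw [measureReal_def, gaussianReal_apply_eq_integral 0 one_ne_zero]
    exact ENNReal.toReal_ofReal (integral_nonneg fun x => gaussianPDFReal_nonneg _ _ _)
  rw [h2]
  have h3 : ∫ x in Set.Icc a (a + 1), Real.exp (-3 * m) = Real.exp (-3 * m) := by simp
  rw [← h3]
  refine setIntegral_mono_on (by simp) (integrable_gaussianPDFReal 0 1).integrableOn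
    measurableSet_Icc fun x hx => ?_
  rw [gaussianPDFReal_def]
  have h4 : Real.sqrt (2 * Real.pi) ≤ Real.exp 1 := by
    rw [Real.sqrt_le_left (Real.exp_pos 1).le]
    have := Real.pi_lt_d2
    have := Real.exp_one_gt_d9
    nlinarith
  have h5 : Real.exp (-1) ≤ (Real.sqrt (2 * Real.pi))⁻¹ := by
    rw [Real.exp_neg]
    exact inv_anti₀ (by positivity) h4
  have h6 : x ^ 2 ≤ 2 * m + 2 := by
    have h7 : x ^ 2 ≤ (a + 1) ^ 2 := by
      have := hx.1; have := hx.2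
      gcongr; linarith
    nlinarith [sq_nonneg (a - 1)]
  simp only [NNReal.coe_one, mul_one, sub_zero]
  calc Real.exp (-3 * m) ≤ Real.exp (-1) * Real.exp (-x ^ 2 / 2) := by
        rw [← Real.exp_add]; exact Real.exp_le_exp.2 (by linarith)
    _ ≤ _ := by gcongr

lemma lintegral_exp_sq_gaussianReal :
    ∫⁻ x, ENNReal.ofReal (Real.exp (x ^ 2 / 4)) ∂(gaussianReal 0 1) ≤
      ENNReal.ofReal (Real.exp 1) := by
  rw [gaussianReal_of_var_ne_zero 0 one_ne_zero,
    lintegral_withDensity_eq_lintegral_mul _ (measurable_gaussianPDF 0 1) (by fun_prop)]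
  have h1 : ∀ x : ℝ, (gaussianPDF 0 1 * fun x => ENNReal.ofReal (Real.exp (x ^ 2 / 4))) x ≤
      ENNReal.ofReal 2 * gaussianPDF 0 2 x := by
    intro x
    rw [Pi.mul_apply, gaussianPDF, gaussianPDF, ← ENNReal.ofReal_mul (gaussianPDFReal_nonneg _ _ _),
      ← ENNReal.ofReal_mul (by positivity)]
    refine ENNReal.ofReal_le_ofReal ?_
    rw [gaussianPDFReal_def, gaussianPDFReal_def]
    simp only [NNReal.coe_one, mul_one, sub_zero, NNReal.coe_ofNat]
    have h2 : (Real.sqrt (2 * Real.pi))⁻¹ ≤ 2 * (Real.sqrt (2 * Real.pi * 2))⁻¹ := by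
      have h3 : Real.sqrt (2 * Real.pi * 2) ≤ 2 * Real.sqrt (2 * Real.pi) := by
        rw [Real.sqrt_le_left (by positivity), mul_pow, Real.sq_sqrt (by positivity)]
        nlinarith [Real.pi_pos]
      rw [← div_eq_mul_inv, le_div_iff₀ (by positivity), inv_mul_le_iff₀ (by positivity)]
      linarith
    rw [mul_assoc, ← Real.exp_add, show -x ^ 2 / 2 + x ^ 2 / 4 = -x ^ 2 / (2 * 2) by ring,
      ← mul_assoc]
    gcongr
  refine (lintegral_mono h1).trans ?_
  rw [lintegral_const_mul _ (measurable_gaussianPDF 0 2),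
    lintegral_gaussianPDF_eq_one 0 two_ne_zero, mul_one]
  exact ENNReal.ofReal_le_ofReal (by linarith [Real.exp_one_gt_d9])

lemma stdNormal_norm_tail (p : ℕ) :
    (stdNormal p).real {g | 32 * (p : ℝ) < sqnorm p g} ≤ Real.exp (-7 * p) := by
  have h1 : ∫⁻ g, ENNReal.ofReal (Real.exp (sqnorm p g / 4)) ∂(stdNormal p) ≤
      ENNReal.ofReal (Real.exp p) := by
    have h2 : ∀ g : Fin p → ℝ, ENNReal.ofReal (Real.exp (sqnorm p g / 4)) =
        ∏ j, ENNReal.ofReal (Real.exp (g j ^ 2 / 4)) := by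
      intro g
      rw [← ENNReal.ofReal_prod_of_nonneg fun _ _ => (Real.exp_pos _).le, ← Real.exp_sum, sqnorm,
        Finset.sum_div]
    simp_rw [h2]
    rw [lintegral_prod_eq_prod_lintegral_of_indepFun Finset.univ
      (fun j (g : Fin p → ℝ) => ENNReal.ofReal (Real.exp (g j ^ 2 / 4)))
      (iIndepFun_pi (X := fun _ x => ENNReal.ofReal (Real.exp (x ^ 2 / 4)))
        fun _ => by fun_prop) (fun _ => by fun_prop)]
    have h3 : ∀ j : Fin p, ∫⁻ g, ENNReal.ofReal (Real.exp (g j ^ 2 / 4)) ∂(stdNormal p) ≤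
        ENNReal.ofReal (Real.exp 1) := fun j => by
      rw [(measurePreserving_eval (fun _ : Fin p => gaussianReal 0 1) j).lintegral_comp
        (f := fun x => ENNReal.ofReal (Real.exp (x ^ 2 / 4))) (by fun_prop)]
      exact lintegral_exp_sq_gaussianReal
    refine (Finset.prod_le_prod' fun j _ => h3 j).trans ?_
    rw [Finset.prod_const, Finset.card_univ, Fintype.card_fin,
      ← ENNReal.ofReal_pow (Real.exp_pos 1).le, ← Real.exp_nat_mul, mul_one]
  have hm : Measurable fun g : Fin p → ℝ => ENNReal.ofReal (Real.exp (sqnorm p g / 4)) := by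
    unfold sqnorm; fun_prop
  have h4 := mul_meas_ge_le_lintegral (μ := stdNormal p) hm
    (ENNReal.ofReal (Real.exp (8 * (p : ℝ))))
  have h5 : stdNormal p {g | 32 * (p : ℝ) < sqnorm p g} ≤ ENNReal.ofReal (Real.exp (-7 * p)) := by
    have h6 : stdNormal p {g | 32 * (p : ℝ) < sqnorm p g} ≤
        stdNormal p {g | ENNReal.ofReal (Real.exp (8 * (p : ℝ))) ≤
          ENNReal.ofReal (Real.exp (sqnorm p g / 4))} := by
      refine measure_mono fun g hg => ENNReal.ofReal_le_ofReal (Real.exp_le_exp.2 ?_)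
      have : 32 * (p : ℝ) < sqnorm p g := hg
      linarith
    have h7 : ENNReal.ofReal (Real.exp (-7 * p)) =
        ENNReal.ofReal (Real.exp (-(8 * (p : ℝ)))) * ENNReal.ofReal (Real.exp p) := by
      rw [← ENNReal.ofReal_mul (Real.exp_pos _).le, ← Real.exp_add]; congr 2; ring
    have h8 : ENNReal.ofReal (Real.exp (-(8 * (p : ℝ)))) * ENNReal.ofReal (Real.exp (8 * (p : ℝ)))
        = 1 := by
      rw [← ENNReal.ofReal_mul (Real.exp_pos _).le, ← Real.exp_add]; simp
    calc _ ≤ _ := h6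
      _ = ENNReal.ofReal (Real.exp (-(8 * (p : ℝ)))) * (ENNReal.ofReal (Real.exp (8 * (p : ℝ))) * _) := by
        rw [← mul_assoc, h8, one_mul]
      _ ≤ _ := by rw [h7]; gcongr; exact h4.trans h1
  exact ENNReal.toReal_le_of_le_ofReal (Real.exp_pos _).le h5

/-- A spherical cap of height `√m` has Gaussian mass at least `exp (-4 m)`, even after
restriction to a ball of radius of order `√p`. -/
lemma stdNormal_cap_ge {p : ℕ} {u : Fin p → ℝ} (hu : sqnorm p u = 1) {m : ℝ} (hm : 1 ≤ m)
    (hmp : m ≤ p) :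
    Real.exp (-4 * m) ≤ (stdNormal p).real
      ({g | Real.sqrt m ≤ ∑ j, g j * u j} ∩ {g | sqnorm p g ≤ 32 * p}) := by
  have hm1 : Measurable fun g : Fin p → ℝ => ∑ j, g j * u j := by fun_prop
  have h1 : Real.exp (-3 * m) ≤ (stdNormal p).real {g | Real.sqrt m ≤ ∑ j, g j * u j} := by
    refine (gaussianReal_Ici_ge hm).trans_eq ?_
    rw [← map_linear_stdNormal hu, map_measureReal_apply hm1 measurableSet_Ici]
    rfl
  have h2 := stdNormal_norm_tail p
  have h3 : (stdNormal p).real {g | Real.sqrt m ≤ ∑ j, g j * u j} ≤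
      (stdNormal p).real ({g | Real.sqrt m ≤ ∑ j, g j * u j} ∩ {g | sqnorm p g ≤ 32 * p}) +
      (stdNormal p).real {g | 32 * (p : ℝ) < sqnorm p g} := by
    refine (measureReal_mono fun g hg => ?_).trans (measureReal_union_le _ _)
    rcases le_or_gt (sqnorm p g) (32 * p) with h | h
    · exact Or.inl ⟨hg, h⟩
    · exact Or.inr h
  have h4 : Real.exp (-7 * p) ≤ Real.exp (-7 * m) := Real.exp_le_exp.2 (by linarith)
  have h5 : Real.exp (-4 * m) = Real.exp (-3 * m) * Real.exp (-m) := by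
    rw [← Real.exp_add]; congr 1; ring
  have h6 : Real.exp (-7 * m) ≤ Real.exp (-3 * m) * Real.exp (-m) := by
    rw [← Real.exp_add]; exact Real.exp_le_exp.2 (by linarith)
  have h7 : Real.exp (-m) ≤ 1 / 2 := by
    have : Real.exp (-m) ≤ Real.exp (-1) := Real.exp_le_exp.2 (by linarith)
    have := Real.exp_neg_one_lt_d9
    linarith
  have := Real.exp_pos (-3 * m)
  nlinarith

end Gaussian

section Mixture

variable {β Ω : Type*} [MeasurableSpace β] [MeasurableSpace Ω]
  {π : Measure β} {P : Measure Ω} {S : β → Ω → ℝ}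

/-- The exponential mixture of the scores `S g` over a prior `π`. -/
noncomputable def mixture (π : Measure β) (S : β → Ω → ℝ) (ω : Ω) : ENNReal :=
  ∫⁻ g, ENNReal.ofReal (Real.exp (S g ω)) ∂π

lemma measurable_mixture [SFinite π] (hS : Measurable (Function.uncurry S)) :
    Measurable (mixture π S) := by
  have : Measurable fun z : β × Ω => ENNReal.ofReal (Real.exp (Function.uncurry S z)) := by
    fun_prop
  exact this.lintegral_prod_left'

lemma lintegral_mixture_le [SFinite π] [SFinite P] (hS : Measurable (Function.uncurry S))
    {K : ENNReal}
    (hK : ∀ᵐ g ∂π, ∫⁻ ω, ENNReal.ofReal (Real.exp (S g ω)) ∂P ≤ K) :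
    ∫⁻ ω, mixture π S ω ∂P ≤ K * π Set.univ := by
  have h1 : Measurable fun z : β × Ω => ENNReal.ofReal (Real.exp (Function.uncurry S z)) := by
    fun_prop
  unfold mixture
  rw [lintegral_lintegral_swap]
  · exact (lintegral_mono_ae hK).trans_eq (lintegral_const K)
  · exact (h1.comp measurable_swap).aemeasurable

lemma measure_mixture_ge_le [SFinite π] [SFinite P] (hS : Measurable (Function.uncurry S))
    {K T : ℝ} (hT : 0 < T) (hπ : π Set.univ ≤ 1)
    (hK : ∀ᵐ g ∂π, ∫⁻ ω, ENNReal.ofReal (Real.exp (S g ω)) ∂P ≤ ENNReal.ofReal K) :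
    P {ω | ENNReal.ofReal T ≤ mixture π S ω} ≤ ENNReal.ofReal (K / T) := by
  rw [ENNReal.ofReal_div_of_pos hT, ENNReal.le_div_iff_mul_le (by simp [hT]) (by simp), mul_comm]
  refine (mul_meas_ge_le_lintegral (measurable_mixture hS) _).trans
    ((lintegral_mixture_le hS hK).trans ?_)
  exact mul_le_of_le_one_right' hπ

lemma measure_mixture_lt_le [IsFiniteMeasure π] [SFinite P]
    (hS : Measurable (Function.uncurry S))
    {K T η : ℝ} (hT : 0 < T) (hη : 0 < η) (hK0 : 0 ≤ K) {A : Set β} (hA : MeasurableSet A)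
    (hπA : η ≤ π.real A)
    (hK : ∀ g ∈ A, ∫⁻ ω, ENNReal.ofReal (Real.exp (-S g ω)) ∂P ≤ ENNReal.ofReal K) :
    P {ω | mixture π S ω < ENNReal.ofReal T} ≤ ENNReal.ofReal (T * K / η) := by
  set c := π.real A with hc
  have hc0 : 0 < c := hη.trans_le hπA
  have hcA : π A = ENNReal.ofReal c := (ofReal_measureReal).symm
  have hneg : Measurable (Function.uncurry fun g ω => -S g ω) := hS.neg
  have hpt : ∀ ω, mixture π S ω < ENNReal.ofReal T →
      ENNReal.ofReal (c ^ 2 / T) ≤ mixture (π.restrict A) (fun g ω => -S g ω) ω := by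
    intro ω hω
    by_contra! hlt
    set l := c / T with hl
    have hl0 : 0 < l := div_pos hc0 hT
    have hSω : Measurable fun g => S g ω := hS.comp (measurable_id.prodMk measurable_const)
    have h1 : ENNReal.ofReal (2 * c) ≤ ENNReal.ofReal l * mixture π S ω +
        ENNReal.ofReal l⁻¹ * mixture (π.restrict A) (fun g ω => -S g ω) ω := by
      calc ENNReal.ofReal (2 * c) = ∫⁻ _ in A, ENNReal.ofReal 2 ∂π := by
            rw [setLIntegral_const, hcA, ENNReal.ofReal_mul (by norm_num)]
        _ ≤ ∫⁻ g in A, (ENNReal.ofReal l * ENNReal.ofReal (Real.exp (S g ω)) +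
              ENNReal.ofReal l⁻¹ * ENNReal.ofReal (Real.exp (-S g ω))) ∂π := by
            refine lintegral_mono fun g => ?_
            rw [← ENNReal.ofReal_mul hl0.le, ← ENNReal.ofReal_mul (inv_pos.2 hl0).le,
              ← ENNReal.ofReal_add (by positivity) (by positivity)]
            refine ENNReal.ofReal_le_ofReal ?_
            have h2 : (l * Real.exp (S g ω)) * (l⁻¹ * Real.exp (-S g ω)) = 1 := by
              rw [Real.exp_neg]; field_simp
            have h3 : 0 < l * Real.exp (S g ω) := by positivity
            have h4 : 0 < l⁻¹ * Real.exp (-S g ω) := by positivity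
            nlinarith [sq_nonneg (l * Real.exp (S g ω) - l⁻¹ * Real.exp (-S g ω))]
        _ = ENNReal.ofReal l * ∫⁻ g in A, ENNReal.ofReal (Real.exp (S g ω)) ∂π +
              ENNReal.ofReal l⁻¹ * mixture (π.restrict A) (fun g ω => -S g ω) ω := by
            rw [lintegral_add_left (by fun_prop), lintegral_const_mul _ (by fun_prop),
              lintegral_const_mul _ (by fun_prop)]
            rfl
        _ ≤ _ := by
            gcongr
            exact setLIntegral_le_lintegral _ _
    have h5 : ENNReal.ofReal l * mixture π S ω < ENNReal.ofReal c := by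
      calc _ < ENNReal.ofReal l * ENNReal.ofReal T :=
            ENNReal.mul_lt_mul_right (by simpa using hl0) (by simp) hω
        _ = _ := by
            rw [← ENNReal.ofReal_mul hl0.le, hl, div_mul_cancel₀ _ hT.ne']
    have h6 : ENNReal.ofReal l⁻¹ * mixture (π.restrict A) (fun g ω => -S g ω) ω <
        ENNReal.ofReal c := by
      calc _ < ENNReal.ofReal l⁻¹ * ENNReal.ofReal (c ^ 2 / T) :=
            ENNReal.mul_lt_mul_right (by simpa using hl0) (by simp) hlt
        _ = _ := by
            rw [← ENNReal.ofReal_mul (inv_pos.2 hl0).le, hl]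
            congr 1
            field_simp
    have h7 := ENNReal.add_lt_add h5 h6
    rw [← ENNReal.ofReal_add hc0.le hc0.le, ← two_mul] at h7
    exact absurd h1 (not_le.2 h7)
  have hcT : 0 < c ^ 2 / T := by positivity
  have h8 : P {ω | mixture π S ω < ENNReal.ofReal T} ≤
      ENNReal.ofReal (K * c) / ENNReal.ofReal (c ^ 2 / T) := by
    rw [ENNReal.le_div_iff_mul_le (by simp [hcT]) (by simp), mul_comm]
    refine le_trans ?_ ((mul_meas_ge_le_lintegral (measurable_mixture (π := π.restrict A) hneg)
      (ENNReal.ofReal (c ^ 2 / T))).trans ((lintegral_mixture_le (K := ENNReal.ofReal K) hneg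
        ((ae_restrict_iff' hA).2 (ae_of_all _ hK))).trans_eq ?_))
    · gcongr
      exact hpt _
    · rw [Measure.restrict_apply_univ, hcA, ENNReal.ofReal_mul hK0]
  refine h8.trans ?_
  rw [← ENNReal.ofReal_div_of_pos hcT]
  refine ENNReal.ofReal_le_ofReal ?_
  rw [show K * c / (c ^ 2 / T) = T * K / c by field_simp]
  gcongr

end Mixture

section Pairs
variable {ι κ E : Type*} [Fintype ι] [MeasurableSpace E] {ν : ι → Measure E}
  [∀ i, IsProbabilityMeasure (ν i)]

/-- Functions of disjoint pairs of coordinates are independent under a product measure. -/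
lemma lintegral_prod_pairs_pi {a b : κ → ι} (ha : Function.Injective a)
    (hb : Function.Injective b) (hab : ∀ i j, a i ≠ b j) {F : κ → E → E → ENNReal}
    (hF : ∀ i, Measurable (Function.uncurry (F i))) (s : Finset κ) :
    ∫⁻ x, ∏ i ∈ s, F i (x (a i)) (x (b i)) ∂(Measure.pi ν) =
      ∏ i ∈ s, ∫⁻ x, F i (x (a i)) (x (b i)) ∂(Measure.pi ν) := by
  have hcomp : ∀ (i : κ) {Z : Type _} [MeasurableSpace Z] {f g : Z → E}, Measurable f →
      Measurable g → Measurable fun z => F i (f z) (g z) := fun i _ _ _ _ hf hg =>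
    (hF i).comp (hf.prodMk hg)
  induction s using Finset.induction_on with
  | empty => simp
  | insert i₀ s hi₀ ih =>
    simp_rw [Finset.prod_insert hi₀]
    rw [← ih]
    set S : Finset ι := {a i₀, b i₀} with hS
    set T : Finset ι := s.image a ∪ s.image b with hT
    have hST : Disjoint S T := by
      rw [Finset.disjoint_left]
      intro j hj hj'
      simp only [hS, hT, Finset.mem_insert, Finset.mem_singleton, Finset.mem_union,
        Finset.mem_image] at hj hj'
      rcases hj with rfl | rfl <;> rcases hj' with ⟨i, hi, h⟩ | ⟨i, hi, h⟩
      · exact hi₀ (ha h ▸ hi)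
      · exact hab _ _ h.symm
      · exact hab _ _ h
      · exact hi₀ (hb h ▸ hi)
    have hind := (iIndepFun_pi (μ := ν) (X := fun _ x => x) fun _ => aemeasurable_id).indepFun_finset
      S T hST fun i => measurable_pi_apply i
    have haT : ∀ i : s, a i ∈ T := fun i =>
      Finset.mem_union_left _ (Finset.mem_image_of_mem a i.2)
    have hbT : ∀ i : s, b i ∈ T := fun i =>
      Finset.mem_union_right _ (Finset.mem_image_of_mem b i.2)
    have haS : a i₀ ∈ S := by simp [hS]
    have hbS : b i₀ ∈ S := by simp [hS]
    have hφ : Measurable fun z : S → E => F i₀ (z ⟨a i₀, haS⟩) (z ⟨b i₀, hbS⟩) :=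
      hcomp i₀ (measurable_pi_apply _) (measurable_pi_apply _)
    have hψ : Measurable fun z : T → E =>
        ∏ i : s, F i (z ⟨a i, haT i⟩) (z ⟨b i, hbT i⟩) :=
      Finset.measurable_fun_prod _ fun i _ =>
        hcomp i (measurable_pi_apply _) (measurable_pi_apply _)
    have h := lintegral_mul_eq_lintegral_mul_lintegral_of_indepFun'' (μ := Measure.pi ν)
      (hφ.comp (by fun_prop)).aemeasurable (hψ.comp (by fun_prop)).aemeasurable (hind.comp hφ hψ)
    simpa only [Function.comp_apply, Finset.univ_eq_attach,
      fun x : ι → E => Finset.prod_attach s fun i => F i (x (a i)) (x (b i))] using h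

lemma lintegral_exp_sum_pairs_le [Fintype κ] {a b : κ → ι} (ha : Function.Injective a)
    (hb : Function.Injective b) (hab : ∀ i j, a i ≠ b j) {c : κ → E → E → ℝ}
    (hc : ∀ i, Measurable (Function.uncurry (c i))) {B : ℝ} (hB : 0 ≤ B)
    (h : ∀ i, ∫⁻ x, ENNReal.ofReal (Real.exp (c i (x (a i)) (x (b i)))) ∂(Measure.pi ν) ≤
      ENNReal.ofReal B) :
    ∫⁻ x, ENNReal.ofReal (Real.exp (∑ i, c i (x (a i)) (x (b i)))) ∂(Measure.pi ν) ≤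
      ENNReal.ofReal (B ^ Fintype.card κ) := by
  simp_rw [Real.exp_sum, ENNReal.ofReal_prod_of_nonneg fun _ _ => (Real.exp_pos _).le]
  rw [lintegral_prod_pairs_pi ha hb hab
    (F := fun i x y => ENNReal.ofReal (Real.exp (c i x y)))
    (fun i => (Real.measurable_exp.comp (hc i)).ennreal_ofReal) Finset.univ]
  refine (Finset.prod_le_prod' fun i _ => h i).trans_eq ?_
  rw [Finset.prod_const, Finset.card_univ, ENNReal.ofReal_pow hB]

end Pairs

section Scores

variable {p n : ℕ} {α : ℝ}

lemma sqnorm_nonneg (v : Fin p → ℝ) : 0 ≤ sqnorm p v :=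
  Finset.sum_nonneg fun _ _ => sq_nonneg _

lemma sqnorm_div_sqrt {v : Fin p → ℝ} (hv : 0 < sqnorm p v) :
    sqnorm p (fun j => v j / Real.sqrt (sqnorm p v)) = 1 := by
  have h : sqnorm p (fun j => v j / Real.sqrt (sqnorm p v)) =
      sqnorm p v / Real.sqrt (sqnorm p v) ^ 2 := by
    conv_lhs => rw [sqnorm]
    simp_rw [div_pow, ← Finset.sum_div]
    rfl
  rw [h, Real.sq_sqrt (sqnorm_nonneg v), div_self hv.ne']

lemma lintegral_abs_inner_rpow_le (hα : 0 < α) {ν : Measure (Fin p → ℝ)} (hν : memW p α ν)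
    (g : Fin p → ℝ) :
    ∫⁻ w, ENNReal.ofReal (|∑ j, g j * w j| ^ α) ∂ν ≤
      ENNReal.ofReal (Real.sqrt (sqnorm p g) ^ α) := by
  rcases (sqnorm_nonneg g).eq_or_lt with h0 | h0
  · have hg : ∀ j, g j = 0 := fun j => by
      have := (Finset.sum_eq_zero_iff_of_nonneg fun j _ => sq_nonneg (g j)).1 h0.symm j
        (Finset.mem_univ j)
      simpa using this
    simp [hg, Real.zero_rpow hα.ne']
  · set c := Real.sqrt (sqnorm p g) with hc
    have hc0 : 0 < c := Real.sqrt_pos.2 h0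
    have h1 : ∀ w : Fin p → ℝ, ENNReal.ofReal (|∑ j, g j * w j| ^ α) =
        ENNReal.ofReal (c ^ α) * ENNReal.ofReal (|∑ j, w j * (g j / c)| ^ α) := by
      intro w
      rw [← ENNReal.ofReal_mul (by positivity), ← Real.mul_rpow hc0.le (abs_nonneg _)]
      congr 2
      rw [← abs_of_pos hc0, ← abs_mul, abs_of_pos hc0, Finset.mul_sum]
      congr 1
      exact Finset.sum_congr rfl fun j _ => by field_simp
    simp_rw [h1]
    rw [lintegral_const_mul' _ _ ENNReal.ofReal_ne_top]
    exact mul_le_of_le_one_right' (hν.2.2 _ (sqnorm_div_sqrt h0))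

lemma integrable_inner {ν : Measure (Fin p → ℝ)} (hν : memW p α ν) (g : Fin p → ℝ) :
    Integrable (fun w => ∑ j, g j * w j) ν :=
  integrable_finsetSum _ fun j _ => (hν.2.1 j).1.const_mul _

lemma integral_inner {ν : Measure (Fin p → ℝ)} (hν : memW p α ν) (g : Fin p → ℝ) :
    ∫ w, ∑ j, g j * w j ∂ν = 0 := by
  rw [integral_finsetSum _ fun j _ => (hν.2.1 j).1.const_mul _]
  exact Finset.sum_eq_zero fun j _ => by rw [integral_const_mul, (hν.2.1 j).2, mul_zero]

variable {ν : Fin n → Measure (Fin p → ℝ)} [∀ t, IsProbabilityMeasure (ν t)]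

lemma integrable_scaled_difference (hν : ∀ t, memW p α (ν t)) (a b : Fin n) (s : ℝ)
    (g : Fin p → ℝ) :
    Integrable (fun X : Fin n → Fin p → ℝ => s * ∑ j, g j * (X a j - X b j)) (Measure.pi ν) := by
  have h : ∀ t, Integrable (fun X : Fin n → Fin p → ℝ => ∑ j, g j * X t j) (Measure.pi ν) :=
    fun t => (measurePreserving_eval ν t).integrable_comp_of_integrable (integrable_inner (hν t) g)
  simp_rw [mul_sub, Finset.sum_sub_distrib]
  exact ((h a).sub (h b)).const_mul s

lemma integral_scaled_difference (hν : ∀ t, memW p α (ν t)) (a b : Fin n) (s : ℝ)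
    (g : Fin p → ℝ) :
    ∫ X, s * ∑ j, g j * (X a j - X b j) ∂(Measure.pi ν) = 0 := by
  have h : ∀ t, Integrable (fun X : Fin n → Fin p → ℝ => ∑ j, g j * X t j) (Measure.pi ν) :=
    fun t => (measurePreserving_eval ν t).integrable_comp_of_integrable (integrable_inner (hν t) g)
  have h0 : ∀ t, ∫ X, ∑ j, g j * X t j ∂(Measure.pi ν) = 0 := fun t => by
    have hm : Measurable fun w : Fin p → ℝ => ∑ j, g j * w j := by fun_prop
    rw [← integral_inner (hν t) g, ← (measurePreserving_eval ν t).map_eq,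
      integral_map (measurable_pi_apply t).aemeasurable hm.aestronglyMeasurable]
  simp_rw [mul_sub, Finset.sum_sub_distrib]
  rw [integral_const_mul, integral_sub (h a) (h b), h0, h0, sub_zero, mul_zero]

lemma lintegral_abs_scaled_difference_rpow_le (hα1 : 1 ≤ α) (hα2 : α ≤ 2)
    (hν : ∀ t, memW p α (ν t)) (a b : Fin n) {s r q : ℝ} (hs : 0 ≤ s)
    {g : Fin p → ℝ} (hg : Real.sqrt (sqnorm p g) ≤ r) (hq : 4 * s ^ α * r ^ α ≤ q) :
    ∫⁻ X, ENNReal.ofReal (|s * ∑ j, g j * (X a j - X b j)| ^ α) ∂(Measure.pi ν) ≤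
      ENNReal.ofReal q := by
  have hr : 0 ≤ r := (Real.sqrt_nonneg _).trans hg
  have h0 : ∀ t, ∫⁻ X, ENNReal.ofReal (|∑ j, g j * X t j| ^ α) ∂(Measure.pi ν) ≤
      ENNReal.ofReal (r ^ α) := fun t => by
    rw [(measurePreserving_eval ν t).lintegral_comp
      (f := fun w => ENNReal.ofReal (|∑ j, g j * w j| ^ α)) (by fun_prop)]
    refine (lintegral_abs_inner_rpow_le (by linarith) (hν t) g).trans
      (ENNReal.ofReal_le_ofReal ?_)
    gcongr
  have h1 : ∀ X : Fin n → Fin p → ℝ, ENNReal.ofReal (|s * ∑ j, g j * (X a j - X b j)| ^ α) ≤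
      ENNReal.ofReal (2 * s ^ α) * (ENNReal.ofReal (|∑ j, g j * X a j| ^ α) +
        ENNReal.ofReal (|∑ j, g j * X b j| ^ α)) := by
    intro X
    rw [← ENNReal.ofReal_add (by positivity) (by positivity),
      ← ENNReal.ofReal_mul (by positivity)]
    refine ENNReal.ofReal_le_ofReal ?_
    simp_rw [mul_sub, Finset.sum_sub_distrib]
    rw [abs_mul, Real.mul_rpow (abs_nonneg _) (abs_nonneg _), abs_of_nonneg hs]
    have := abs_add_rpow_le hα1 hα2 (∑ j, g j * X a j) (-∑ j, g j * X b j)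
    rw [abs_neg, ← sub_eq_add_neg] at this
    nlinarith [Real.rpow_nonneg hs α]
  refine (lintegral_mono h1).trans ?_
  rw [lintegral_const_mul' _ _ ENNReal.ofReal_ne_top, lintegral_add_left (by fun_prop)]
  calc _ ≤ ENNReal.ofReal (2 * s ^ α) * (ENNReal.ofReal (r ^ α) + ENNReal.ofReal (r ^ α)) := by
        gcongr
        · exact h0 a
        · exact h0 b
    _ = ENNReal.ofReal (4 * s ^ α * r ^ α) := by
        rw [← ENNReal.ofReal_add (by positivity) (by positivity),
          ← ENNReal.ofReal_mul (by positivity)]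
        congr 1; ring
    _ ≤ _ := ENNReal.ofReal_le_ofReal hq

/-- Sum of truncated differences of paired columns, projected on the direction `g`. -/
noncomputable def score {N : ℕ} (a b : Fin N → Fin n) (L s : ℝ) (g : Fin p → ℝ)
    (X : Fin n → Fin p → ℝ) : ℝ :=
  ∑ i, clip L (s * ∑ j, g j * (X (a i) j - X (b i) j))

lemma measurable_score {N : ℕ} (a b : Fin N → Fin n) (L s : ℝ) :
    Measurable (Function.uncurry (score (p := p) a b L s)) := by
  have := measurable_clip L
  unfold Function.uncurry score
  fun_prop

variable {N : ℕ} {a b : Fin N → Fin n} {L q y B f s r : ℝ} {g : Fin p → ℝ}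

lemma lintegral_exp_score_le (hα1 : 1 ≤ α) (hα2 : α ≤ 2) (hν : ∀ t, memW p α (ν t))
    (ha : Function.Injective a) (hb : Function.Injective b) (hab : ∀ i j, a i ≠ b j)
    (hS : ScoreParams α L q y B f) (hs : 0 ≤ s) (hg : Real.sqrt (sqnorm p g) ≤ r)
    (hq : 4 * s ^ α * r ^ α ≤ q) :
    ∫⁻ X, ENNReal.ofReal (Real.exp (score a b L s g X)) ∂(Measure.pi ν) ≤
      ENNReal.ofReal (B ^ N) := by
  have hm := measurable_clip L
  have h := lintegral_exp_sum_pairs_le (ν := ν) ha hb hab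
    (c := fun _ w w' => clip L (s * ∑ j, g j * (w j - w' j)))
    (fun _ => by unfold Function.uncurry; fun_prop) hS.b_pos.le fun i =>
    (lintegral_exp_clip_le hα1 hα2 hS.one_le_L hS.q_pos.le
      (integrable_scaled_difference hν (a i) (b i) s g)
      (integral_scaled_difference hν (a i) (b i) s g)
      (lintegral_abs_scaled_difference_rpow_le hα1 hα2 hν (a i) (b i) hs hg hq)).trans
      (ENNReal.ofReal_le_ofReal hS.null_le)
  simpa only [score, Fintype.card_fin] using h

lemma lintegral_exp_neg_score_le (hα1 : 1 ≤ α) (hα2 : α ≤ 2) (hν : ∀ t, memW p α (ν t))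
    (ha : Function.Injective a) (hb : Function.Injective b) (hab : ∀ i j, a i ≠ b j)
    (hS : ScoreParams α L q y B f) (hs : 0 ≤ s) (hg : Real.sqrt (sqnorm p g) ≤ r)
    (hq : 4 * s ^ α * r ^ α ≤ q) {θ : Fin n → Fin p → ℝ} {μ : Fin p → ℝ}
    (hθ : ∀ i j, θ (a i) j - θ (b i) j = μ j) (hy : y ≤ s * ∑ j, g j * μ j) :
    ∫⁻ X, ENNReal.ofReal (Real.exp (-score a b L s g (θ + X))) ∂(Measure.pi ν) ≤
      ENNReal.ofReal (f ^ N) := by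
  have hm := measurable_clip L
  have hsc : ∀ X, -score a b L s g (θ + X) = ∑ i,
      -clip L (s * (∑ j, g j * μ j) + s * ∑ j, g j * (X (a i) j - X (b i) j)) := by
    intro X
    rw [score, ← Finset.sum_neg_distrib]
    refine Finset.sum_congr rfl fun i _ => ?_
    rw [← mul_add, ← Finset.sum_add_distrib]
    congr 3
    refine Finset.sum_congr rfl fun j _ => ?_
    rw [← hθ i j, Pi.add_apply, Pi.add_apply, Pi.add_apply, Pi.add_apply]
    ring
  simp_rw [hsc]
  have h := lintegral_exp_sum_pairs_le (ν := ν) ha hb hab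
    (c := fun _ w w' => -clip L (s * (∑ j, g j * μ j) + s * ∑ j, g j * (w j - w' j)))
    (fun _ => by unfold Function.uncurry; fun_prop) hS.f_pos.le fun i => by
    have hV := integrable_scaled_difference hν (a i) (b i) s g
    have hV0 := integral_scaled_difference hν (a i) (b i) s g
    have hVq := lintegral_abs_scaled_difference_rpow_le hα1 hα2 hν (a i) (b i) hs hg hq
    rcases hS.alt_le with ⟨h1, h2⟩ | h1
    · exact (lintegral_exp_neg_clip_add_le_of_large hα1 hS.one_le_L hS.q_pos.le (h1.trans hy) hV
        hVq).trans (ENNReal.ofReal_le_ofReal h2)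
    · exact (lintegral_exp_neg_clip_add_le_of_small hα1 hα2 hS.one_le_L hS.q_pos.le hS.y_pos.le hy
        hV hV0 hVq).trans (ENNReal.ofReal_le_ofReal h1)
  simpa only [Fintype.card_fin] using h

end Scores
section SingleScale

lemma measurable_score_add {p n N : ℕ} (a b : Fin N → Fin n) (L s : ℝ)
    (θ : Fin n → Fin p → ℝ) :
    Measurable (Function.uncurry fun g X => score a b L s g (θ + X)) := by
  have := measurable_clip L
  unfold Function.uncurry score
  simp only [Pi.add_apply]
  fun_prop

/-- A rejection region for one scale `N`: comparing the first `N` columns with the last `N`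
columns, it has level `δ` and misses with probability at most `η` any change of the mean of
sufficient size located at distance at least `N` from the boundary. -/
lemma exists_rejection_region {α C₁ h₀ : ℝ} (hα1 : 1 ≤ α) (hα2 : α ≤ 2)
    (hC₁ : ∀ h : ℝ, 0 < h → h ≤ h₀ → ∃ L q y b f : ℝ, ScoreParams α L q y b f ∧
      b * f ≤ Real.exp (-h) ∧ y * (4 / q) ^ (1 / α) ≤ C₁ * h ^ ((α - 1) / α))
    {p n N : ℕ} (hp : 0 < p) (hN : 0 < N) (hNn : 2 * N ≤ n) {δ η m H : ℝ}
    (hδ : 0 < δ) (hη : 0 < η) (hm : 1 ≤ m) (hmp : m ≤ p)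
    (hH : H = 4 * m + Real.log (1 / (δ * η))) (hH0 : 0 < H) (hHN : H / N ≤ h₀) :
    ∃ D : Set (Fin n → Fin p → ℝ), MeasurableSet D ∧
      ∀ ν : Fin n → Measure (Fin p → ℝ), (∀ t, memW p α (ν t)) →
        (∀ θ ∈ Theta0 p n, Measure.pi ν {E | θ + E ∈ D} ≤ ENNReal.ofReal δ) ∧
        ∀ (θ : Fin n → Fin p → ℝ) (μ₁ μ₂ : Fin p → ℝ) (t0 : ℕ), N ≤ t0 → N ≤ n - t0 →
          (∀ t : Fin n, (t : ℕ) < t0 → θ t = μ₁) → (∀ t : Fin n, t0 ≤ (t : ℕ) → θ t = μ₂) →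
          Real.sqrt (32 * p) * (C₁ * (H / N) ^ ((α - 1) / α)) ≤
            Real.sqrt (sqnorm p fun j => μ₁ j - μ₂ j) * Real.sqrt m →
          Measure.pi ν {E | θ + E ∉ D} ≤ ENNReal.ofReal η := by
  have hα0 : 0 < α := by linarith
  have hN' : (0 : ℝ) < N := by exact_mod_cast hN
  have hp' : (0 : ℝ) < p := by exact_mod_cast hp
  obtain ⟨L, q, y, B, f, hS, hBf, hy⟩ := hC₁ (H / N) (by positivity) hHN
  have hq0 := hS.q_pos
  have hB0 := hS.b_pos
  have hf0 := hS.f_pos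
  have hy0 := hS.y_pos
  set a : Fin N → Fin n := fun i => ⟨i, by omega⟩ with ha_def
  set b : Fin N → Fin n := fun i => ⟨n - 1 - i, by omega⟩ with hb_def
  have ha : Function.Injective a := fun i j h => by
    simp only [ha_def, Fin.mk.injEq] at h
    exact Fin.ext h
  have hb : Function.Injective b := fun i j h => by
    simp only [hb_def, Fin.mk.injEq] at h
    exact Fin.ext (by omega)
  have hab : ∀ i j, a i ≠ b j := fun i j h => by
    simp only [ha_def, hb_def, Fin.mk.injEq] at h
    omega
  set r := Real.sqrt (32 * p) with hr_def
  have hr0 : 0 < r := Real.sqrt_pos.2 (by positivity)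
  set s := (q / 4) ^ (1 / α) / r with hs_def
  have hs0 : 0 < s := by positivity
  have hsr : 4 * s ^ α * r ^ α ≤ q := by
    rw [mul_assoc, ← Real.mul_rpow hs0.le hr0.le, hs_def, div_mul_cancel₀ _ hr0.ne',
      ← Real.rpow_mul (by positivity), one_div, inv_mul_cancel₀ hα0.ne', Real.rpow_one]
    linarith
  set ball : Set (Fin p → ℝ) := {g | sqnorm p g ≤ 32 * p} with hball
  have hballm : MeasurableSet ball :=
    measurableSet_le (by unfold sqnorm; fun_prop) measurable_const
  have hgr : ∀ g ∈ ball, Real.sqrt (sqnorm p g) ≤ r := fun g hg => Real.sqrt_le_sqrt hg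
  set π := (stdNormal p).restrict ball with hπ
  have hπ1 : π Set.univ ≤ 1 := by
    rw [hπ, Measure.restrict_apply_univ]; exact prob_le_one
  have hSm := measurable_score (p := p) a b L s
  set T := B ^ N / δ with hT
  have hT0 : 0 < T := by positivity
  refine ⟨{X | ENNReal.ofReal T ≤ mixture π (score a b L s) X},
    measurableSet_le measurable_const (measurable_mixture hSm), fun ν hν => ?_⟩
  have hprob : ∀ t, IsProbabilityMeasure (ν t) := fun t => (hν t).1
  have hshift : ∀ θ : Fin n → Fin p → ℝ,
      Measurable (Function.uncurry fun g X => score a b L s g (θ + X)) := measurable_score_add a b L s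
  constructor
  · rintro θ ⟨μ, hθ⟩
    have h := measure_mixture_ge_le (P := Measure.pi ν) (π := π) (hshift θ) (K := B ^ N) hT0 hπ1
      ((ae_restrict_iff' hballm).2 (ae_of_all _ fun g hg => by
        have hθ' : ∀ X, score a b L s g (θ + X) = score a b L s g X := fun X => by
          simp [score, hθ]
        simp_rw [hθ']
        exact lintegral_exp_score_le hα1 hα2 hν ha hb hab hS hs0.le (hgr g hg) hsr))
    rwa [hT, div_div_cancel₀ (by positivity)] at h
  · intro θ μ₁ μ₂ t0 ht0 ht0' hθ₁ hθ₂ hsig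
    set μ : Fin p → ℝ := fun j => μ₁ j - μ₂ j with hμ
    set c := Real.sqrt (sqnorm p μ) with hc
    have hθ : ∀ i j, θ (a i) j - θ (b i) j = μ j := fun i j => by
      rw [hθ₁ (a i) (lt_of_lt_of_le i.2 ht0), hθ₂ (b i) (by
        have := i.2
        simp only [hb_def]
        omega)]
    have hyc : y ≤ s * (c * Real.sqrt m) := by
      have h1 : (q / 4) ^ (1 / α) * (4 / q) ^ (1 / α) = 1 := by
        rw [← Real.mul_rpow (by positivity) (by positivity),
          show q / 4 * (4 / q) = 1 by field_simp, Real.one_rpow]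
      calc y = (q / 4) ^ (1 / α) * (y * (4 / q) ^ (1 / α)) := by
            rw [mul_left_comm, h1, mul_one]
        _ ≤ (q / 4) ^ (1 / α) * (C₁ * (H / N) ^ ((α - 1) / α)) := by gcongr
        _ = s * (r * (C₁ * (H / N) ^ ((α - 1) / α))) := by
            rw [hs_def]; field_simp
        _ ≤ _ := by gcongr
    have hc0 : 0 < c := by
      rcases (Real.sqrt_nonneg (sqnorm p μ)).eq_or_lt with h | h
      · rw [hc, ← h, zero_mul, mul_zero] at hyc
        linarith
      · exact h
    have hu := sqnorm_div_sqrt (Real.sqrt_pos.1 hc0)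
    set A := {g : Fin p → ℝ | Real.sqrt m ≤ ∑ j, g j * (μ j / c)} ∩ ball with hA
    have hAm : MeasurableSet A :=
      (measurableSet_le measurable_const (by fun_prop)).inter hballm
    have hcap : Real.exp (-4 * m) ≤ π.real A := by
      rw [hπ, measureReal_restrict_apply hAm, hA, Set.inter_assoc, Set.inter_self]
      exact stdNormal_cap_ge hu hm hmp
    have h := measure_mixture_lt_le (P := Measure.pi ν) (π := π) (hshift θ) (K := f ^ N) hT0
      (Real.exp_pos _) (by positivity) hAm hcap fun g hg =>
        lintegral_exp_neg_score_le hα1 hα2 hν ha hb hab hS hs0.le (hgr g hg.2) hsr hθ (by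
          refine hyc.trans ?_
          gcongr
          have h2 : ∑ j, g j * μ j = c * ∑ j, g j * (μ j / c) := by
            rw [Finset.mul_sum]
            exact Finset.sum_congr rfl fun j _ => by field_simp
          rw [h2]
          gcongr
          exact hg.1)
    have h3 : {E | θ + E ∉ {X | ENNReal.ofReal T ≤ mixture π (score a b L s) X}} =
        {E | mixture π (fun g X => score a b L s g (θ + X)) E < ENNReal.ofReal T} := by
      ext E
      change ¬(ENNReal.ofReal T ≤ mixture π (score a b L s) (θ + E)) ↔
        mixture π (score a b L s) (θ + E) < ENNReal.ofReal T
      exact not_le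
    rw [h3]
    refine h.trans (ENNReal.ofReal_le_ofReal ?_)
    have h4 : (B * f) ^ N ≤ Real.exp (-(4 * m)) * (δ * η) := by
      calc (B * f) ^ N ≤ Real.exp (-(H / N)) ^ N := by gcongr
        _ = Real.exp (-(4 * m) + Real.log (δ * η)) := by
            rw [← Real.exp_nat_mul, hH, one_div, Real.log_inv]
            congr 1
            field_simp
            ring
        _ = _ := by rw [Real.exp_add, Real.exp_log (by positivity)]
    rw [div_le_iff₀ (Real.exp_pos _), hT, div_mul_eq_mul_div, ← mul_pow,
      div_le_iff₀ hδ, show -4 * m = -(4 * m) by ring]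
    linarith

end SingleScale
section Risk

lemma eq_pi_of_rectangles {p n : ℕ} {P : Measure (Fin n → Fin p → ℝ)}
    {ν : Fin n → Measure (Fin p → ℝ)} [∀ t, IsProbabilityMeasure (ν t)]
    (h : ∀ s : Fin n → Set (Fin p → ℝ), (∀ t, MeasurableSet (s t)) →
      P {x | ∀ t, x t ∈ s t} = ∏ t, ν t (s t)) : P = Measure.pi ν := by
  refine (Measure.pi_eq fun s hs => ?_).symm
  rw [← h s hs]
  congr 1
  ext x
  simp

lemma integral_ite_mem_le {Ω : Type*} [MeasurableSpace Ω] {P : Measure Ω} {s : Set Ω} {e : ℝ}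
    (hs : MeasurableSet s) (he : 0 ≤ e) (h : P s ≤ ENNReal.ofReal e) :
    ∫ ω, (if ω ∈ s then (1 : ℝ) else 0) ∂P ≤ e := by
  have : (fun ω => if ω ∈ s then (1 : ℝ) else 0) = s.indicator fun _ => 1 := by
    ext ω; simp [Set.indicator]
  rw [this, integral_indicator_const _ hs, smul_eq_mul, mul_one]
  exact ENNReal.toReal_le_of_le_ofReal he h

lemma risk_ite_mem_le {p n : ℕ} {Q : Set (Measure (Fin n → Fin p → ℝ))}
    {Θ : Set (Fin n → Fin p → ℝ)} {R : Set (Fin n → Fin p → ℝ)} (hR : MeasurableSet R)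
    {e₁ e₂ : ℝ} (he₁ : 0 ≤ e₁) (he₂ : 0 ≤ e₂)
    (h₁ : ∀ P ∈ Q, ∀ θ ∈ Theta0 p n, P {E | θ + E ∈ R} ≤ ENNReal.ofReal e₁)
    (h₂ : ∀ P ∈ Q, ∀ θ ∈ Θ, P {E | θ + E ∉ R} ≤ ENNReal.ofReal e₂) :
    risk p n Q Θ (fun X => if X ∈ R then 1 else 0) ≤ e₁ + e₂ := by
  have hRθ : ∀ θ : Fin n → Fin p → ℝ, MeasurableSet {E | θ + E ∈ R} := fun θ =>
    (measurable_const_add θ) hR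
  refine add_le_add ?_ ?_
  · refine Real.iSup_le (fun P => Real.iSup_le (fun hP => Real.iSup_le (fun θ =>
      Real.iSup_le (fun hθ => ?_) he₁) he₁) he₁) he₁
    exact integral_ite_mem_le (hRθ θ) he₁ (h₁ P hP θ hθ)
  · refine Real.iSup_le (fun P => Real.iSup_le (fun hP => Real.iSup_le (fun θ =>
      Real.iSup_le (fun hθ => ?_) he₂) he₂) he₂) he₂
    refine (integral_congr_ae (ae_of_all _ fun E => ?_)).trans_le
      (integral_ite_mem_le (hRθ θ).compl he₂ (h₂ P hP θ hθ))
    by_cases hE : θ + E ∈ R <;> simp [hE]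

end Risk

section Calibration

lemma sum_inv_mul_succ_le (ε : ℝ) (hε : 0 ≤ ε) (n : ℕ) :
    ∑ k ∈ Finset.range n, ε / (((k : ℝ) + 1) * (k + 2)) ≤ ε := by
  have h : ∑ k ∈ Finset.range n, ε / (((k : ℝ) + 1) * (k + 2)) = ε - ε / (n + 1) := by
    induction n with
    | zero => simp
    | succ n ih =>
      rw [Finset.sum_range_succ, ih]
      push_cast
      field_simp
      ring
  rw [h]
  have : 0 ≤ ε / (n + 1 : ℝ) := by positivity
  linarith

variable {ε : ℝ} {k : ℕ}

lemma log_inv_level_le (hε : 0 < ε) :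
    Real.log (1 / (ε / 2 / (((k : ℝ) + 1) * (k + 2)) * (ε / 2))) ≤
      Real.log (4 / ε ^ 2) + 2 * Real.log (k + 2) := by
  have h : 1 / (ε / 2 / (((k : ℝ) + 1) * (k + 2)) * (ε / 2)) ≤ 4 / ε ^ 2 * (k + 2) ^ 2 := by
    have h1 : 1 / (ε / 2 / (((k : ℝ) + 1) * (k + 2)) * (ε / 2)) =
        4 / ε ^ 2 * (((k : ℝ) + 1) * (k + 2)) := by
      field_simp; norm_num
    rw [h1]
    gcongr
    nlinarith [(Nat.cast_nonneg k : (0 : ℝ) ≤ k)]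
  refine (Real.log_le_log (by positivity) h).trans_eq ?_
  rw [Real.log_mul (by positivity) (by positivity), Real.log_pow]
  norm_num

lemma log_inv_level_nonneg (hε : 0 < ε) (hε1 : ε < 1) :
    0 ≤ Real.log (1 / (ε / 2 / (((k : ℝ) + 1) * (k + 2)) * (ε / 2))) := by
  refine Real.log_nonneg ((one_le_div (by positivity)).2 ?_)
  have h1 : ε / 2 / (((k : ℝ) + 1) * (k + 2)) ≤ 1 := by
    rw [div_le_one (by positivity)]
    nlinarith [(Nat.cast_nonneg k : (0 : ℝ) ≤ k)]
  have h2 : 0 ≤ ε / 2 / (((k : ℝ) + 1) * (k + 2)) := by positivity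
  nlinarith

lemma log_four_div_sq_nonneg (hε : 0 < ε) (hε1 : ε < 1) : 0 ≤ Real.log (4 / ε ^ 2) := by
  refine Real.log_nonneg ((one_le_div (by positivity)).2 ?_)
  nlinarith

lemma log_add_two_le_two_pow (k : ℕ) : Real.log ((k : ℝ) + 2) ≤ (2 : ℝ) ^ k := by
  have h1 := Real.log_le_sub_one_of_pos (by positivity : (0 : ℝ) < k + 2)
  have h2 : (k : ℝ) + 1 ≤ 2 ^ k := by exact_mod_cast Nat.lt_two_pow_self (n := k)
  linarith

lemma log_log_nonneg {n : ℕ} (hn : 3 ≤ n) : 0 ≤ Real.log (Real.log n) := by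
  have hn' : (3 : ℝ) ≤ n := by exact_mod_cast hn
  refine Real.log_nonneg ((Real.le_log_iff_exp_le (by linarith)).2 ?_)
  linarith [Real.exp_one_lt_d9]

lemma log_add_two_le_log_log {n : ℕ} (hn : 3 ≤ n) (hk : 2 * 2 ^ k ≤ n) :
    Real.log ((k : ℝ) + 2) ≤ 2 + Real.log (Real.log n) := by
  have hn' : (3 : ℝ) ≤ n := by exact_mod_cast hn
  have hlog : 0 < Real.log n := Real.log_pos (by linarith)
  have h1 : ((k : ℝ) + 1) * Real.log 2 ≤ Real.log n := by
    have h : ((2 : ℝ) ^ (k + 1)) ≤ n := by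
      rw [pow_succ']; exact_mod_cast hk
    have := Real.log_le_log (by positivity) h
    rw [Real.log_pow] at this
    exact_mod_cast this
  have h2 : (k : ℝ) + 2 ≤ 3 * Real.log n := by
    have := Real.log_two_gt_d9
    nlinarith [(Nat.cast_nonneg k : (0 : ℝ) ≤ k)]
  have h3 := Real.log_le_log (by positivity) h2
  rw [Real.log_mul (by norm_num) hlog.ne'] at h3
  have := Real.log_le_sub_one_of_pos (by norm_num : (0 : ℝ) < 3)
  linarith

/-- The signal-to-noise inequality required at scale `2 ^ k` follows from the separation
condition at a change point `τ ∈ [2 ^ k, 2 ^ (k + 1))`. -/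
lemma signal_at_scale {β C₁ A h₀ H ℓ c τ N : ℝ} {p : ℕ} (hβ0 : 0 ≤ β) (hβ1 : β ≤ 1) (hC₁ : 0 ≤ C₁)
    (hA : 1 ≤ A) (hp : 0 < p) (hN : 0 < N) (hNτ : N ≤ τ) (hτN : τ ≤ 2 * N) (hH0 : 0 ≤ H)
    (hHN : H / N ≤ h₀) (hHA : H ≤ A * (p + ℓ)) (hℓ : 0 ≤ ℓ)
    (hc : Real.sqrt 32 * C₁ * (2 * h₀ ^ β + 2 * A) *
      (Real.sqrt (p / τ) + (p / τ) ^ β + (ℓ / τ) ^ β) ≤ c) :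
    Real.sqrt (32 * p) * (C₁ * (H / N) ^ β) ≤ c * Real.sqrt (min N p) := by
  have hp' : (0 : ℝ) < p := by exact_mod_cast hp
  have hτ : 0 < τ := hN.trans_le hNτ
  have hh₀ : 0 ≤ h₀ := le_trans (by positivity) hHN
  have e1 : 0 ≤ h₀ ^ β := by positivity
  have e2 : 0 ≤ (p / τ : ℝ) ^ β := by positivity
  have e3 : 0 ≤ (ℓ / τ : ℝ) ^ β := by positivity
  have e4 : 0 ≤ Real.sqrt (p / τ) := by positivity
  have e5 : 0 ≤ Real.sqrt 32 * C₁ := by positivity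
  rw [Real.sqrt_mul (by norm_num)]
  rcases le_total N p with h | h
  · rw [min_eq_left h]
    have h1 : Real.sqrt p ≤ 2 * (Real.sqrt (p / τ) * Real.sqrt N) := by
      rw [← Real.sqrt_mul (by positivity)]
      have h2 : Real.sqrt (p : ℝ) ≤ Real.sqrt (2 ^ 2 * (p / τ * N)) := by
        refine Real.sqrt_le_sqrt ?_
        rw [div_mul_eq_mul_div, ← mul_div_assoc, le_div_iff₀ hτ]
        nlinarith
      rwa [Real.sqrt_mul (by norm_num), Real.sqrt_sq (by norm_num)] at h2
    calc Real.sqrt 32 * Real.sqrt p * (C₁ * (H / N) ^ β)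
        = Real.sqrt 32 * C₁ * (H / N) ^ β * Real.sqrt p := by ring
      _ ≤ Real.sqrt 32 * C₁ * h₀ ^ β * (2 * (Real.sqrt (p / τ) * Real.sqrt N)) := by gcongr
      _ = Real.sqrt 32 * C₁ * (2 * h₀ ^ β) * Real.sqrt (p / τ) * Real.sqrt N := by ring
      _ ≤ Real.sqrt 32 * C₁ * (2 * h₀ ^ β + 2 * A) *
          (Real.sqrt (p / τ) + (p / τ) ^ β + (ℓ / τ) ^ β) * Real.sqrt N := by
          gcongr <;> linarith
      _ ≤ _ := by gcongr
  · rw [min_eq_right h]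
    have h1 : (H / N) ^ β ≤ 2 * A * ((p / τ) ^ β + (ℓ / τ) ^ β) := by
      have h2 : H / N ≤ 2 * A * (p / τ + ℓ / τ) := by
        rw [div_le_iff₀ hN, ← add_div, ← mul_div_assoc, div_mul_eq_mul_div, le_div_iff₀ hτ]
        have : 0 ≤ A * (p + ℓ) := by positivity
        nlinarith
      calc (H / N) ^ β ≤ (2 * A * (p / τ + ℓ / τ)) ^ β := by gcongr
        _ = (2 * A) ^ β * (p / τ + ℓ / τ) ^ β := Real.mul_rpow (by positivity) (by positivity)
        _ ≤ 2 * A * ((p / τ) ^ β + (ℓ / τ) ^ β) := by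
          gcongr
          · exact Real.rpow_le_self_of_one_le (by linarith) hβ1
          · exact Real.rpow_add_le_add_rpow (by positivity) (by positivity) hβ0 hβ1
    calc Real.sqrt 32 * Real.sqrt p * (C₁ * (H / N) ^ β)
        = Real.sqrt 32 * C₁ * (H / N) ^ β * Real.sqrt p := by ring
      _ ≤ Real.sqrt 32 * C₁ * (2 * A * ((p / τ) ^ β + (ℓ / τ) ^ β)) * Real.sqrt p := by gcongr
      _ = Real.sqrt 32 * C₁ * (2 * A) * ((p / τ) ^ β + (ℓ / τ) ^ β) * Real.sqrt p := by ring
      _ ≤ Real.sqrt 32 * C₁ * (2 * h₀ ^ β + 2 * A) *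
          (Real.sqrt (p / τ) + (p / τ) ^ β + (ℓ / τ) ^ β) * Real.sqrt p := by
          gcongr <;> linarith
      _ ≤ _ := by gcongr

end Calibration
end

/-- Theorem: testing with fewer than two finite moments, upper bound. -/
theorem statement_11 (α ε : ℝ) (hα1 : 1 < α) (hα2 : α ≤ 2) (hε0 : 0 < ε) (hε1 : ε < 1) :
    ∃ C : ℝ, 0 < C ∧
      ∀ p n : ℕ, 0 < p → 3 ≤ n → ∀ ρ : ℕ → ℝ,
        (∀ t0 : ℕ, 1 ≤ t0 → t0 ≤ n - 1 →
          C * (Real.sqrt ((p : ℝ) / ((min t0 (n - t0) : ℕ) : ℝ)) +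
            ((p : ℝ) / ((min t0 (n - t0) : ℕ) : ℝ)) ^ ((α - 1) / α) +
            (Real.log (Real.log (n : ℝ)) / ((min t0 (n - t0) : ℕ) : ℝ)) ^ ((α - 1) / α)) ≤ ρ t0) →
        ∃ φ : (Fin n → Fin p → ℝ) → ℝ, IsTest p n φ ∧
          risk p n (Wclass p n α) (ThetaSeq p n ρ) φ ≤ ε := by
  set β := (α - 1) / α with hβ
  have hα0 : 0 < α := by linarith
  have hβ0 : 0 ≤ β := div_nonneg (by linarith) hα0.le
  have hβ1 : β ≤ 1 := (div_le_one hα0).2 (by linarith)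
  set l := Real.log (4 / ε ^ 2) with hl
  have hl0 : 0 ≤ l := log_four_div_sq_nonneg hε0 hε1
  obtain ⟨C₁, hC₁, hscore⟩ := exists_scoreParams hα1 (h₀ := 6 + l) (by linarith)
  have hh₀ : 0 ≤ (6 + l) ^ β := by positivity
  refine ⟨Real.sqrt 32 * C₁ * (2 * (6 + l) ^ β + 2 * (8 + l)), by positivity, ?_⟩
  intro p n hp hn ρ hρ
  have hp1 : (1 : ℝ) ≤ p := by exact_mod_cast hp
  have hℓ := log_log_nonneg hn
  set ℓ := Real.log (Real.log n)
  set δ : ℕ → ℝ := fun k => ε / 2 / (((k : ℝ) + 1) * (k + 2)) with hδ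
  have hδ0 : ∀ k, 0 < δ k := fun k => by positivity
  set m : ℕ → ℝ := fun k => min (2 ^ k) p with hm
  set H : ℕ → ℝ := fun k => 4 * m k + Real.log (1 / (δ k * (ε / 2))) with hH
  have hm1 : ∀ k, 1 ≤ m k := fun k => le_min (one_le_pow₀ (by norm_num)) hp1
  have hH0 : ∀ k, 0 < H k := fun k => by
    have h1 : 0 ≤ Real.log (1 / (δ k * (ε / 2))) := log_inv_level_nonneg hε0 hε1
    have := hm1 k
    simp only [hH]
    linarith
  have hHle : ∀ k, H k ≤ 4 * m k + (l + 2 * Real.log (k + 2)) := fun k =>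
    add_le_add_right (log_inv_level_le hε0) _
  have hHN : ∀ k, H k / ((2 ^ k : ℕ) : ℝ) ≤ 6 + l := fun k => by
    have h1 : m k ≤ 2 ^ k := min_le_left _ _
    have h2 := log_add_two_le_two_pow k
    have h3 : (1 : ℝ) ≤ 2 ^ k := one_le_pow₀ (by norm_num)
    have := hHle k
    push_cast
    rw [div_le_iff₀ (by positivity)]
    nlinarith
  have hHA : ∀ k, 2 * 2 ^ k ≤ n → H k ≤ (8 + l) * (p + ℓ) := fun k hk => by
    have h1 : m k ≤ p := min_le_right _ _
    have h2 := log_add_two_le_log_log hn hk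
    have := hHle k
    have h4 : 0 ≤ l * (p - 1) := mul_nonneg hl0 (by linarith)
    have h5 : 0 ≤ l * ℓ := mul_nonneg hl0 hℓ
    nlinarith
  have hD : ∀ k, ∃ D : Set (Fin n → Fin p → ℝ), MeasurableSet D ∧ (2 * 2 ^ k ≤ n →
      ∀ ν : Fin n → Measure (Fin p → ℝ), (∀ t, memW p α (ν t)) →
        (∀ θ ∈ Theta0 p n, Measure.pi ν {E | θ + E ∈ D} ≤ ENNReal.ofReal (δ k)) ∧
        ∀ (θ : Fin n → Fin p → ℝ) (μ₁ μ₂ : Fin p → ℝ) (t0 : ℕ), 2 ^ k ≤ t0 → 2 ^ k ≤ n - t0 →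
          (∀ t : Fin n, (t : ℕ) < t0 → θ t = μ₁) → (∀ t : Fin n, t0 ≤ (t : ℕ) → θ t = μ₂) →
          Real.sqrt (32 * p) * (C₁ * (H k / ((2 ^ k : ℕ) : ℝ)) ^ β) ≤
            Real.sqrt (sqnorm p fun j => μ₁ j - μ₂ j) * Real.sqrt (m k) →
          Measure.pi ν {E | θ + E ∉ D} ≤ ENNReal.ofReal (ε / 2)) := by
    intro k
    by_cases hk : 2 * 2 ^ k ≤ n
    · obtain ⟨D, hDm, hD⟩ := exists_rejection_region hα1.le hα2 hscore hp
        (N := 2 ^ k) (by positivity) hk (hδ0 k) (half_pos hε0) (hm1 k) (min_le_right _ _)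
        (H := H k) rfl (hH0 k) (hHN k)
      exact ⟨D, hDm, fun _ => hD⟩
    · exact ⟨∅, MeasurableSet.empty, fun h => absurd h hk⟩
  choose D hDm hD using hD
  set K := (Finset.range n).filter fun k => 2 * 2 ^ k ≤ n with hK
  set R : Set (Fin n → Fin p → ℝ) := ⋃ k ∈ K, D k with hR
  have hRm : MeasurableSet R := Finset.measurableSet_biUnion _ fun k _ => hDm k
  refine ⟨fun X => if X ∈ R then 1 else 0,
    ⟨Measurable.ite hRm measurable_const measurable_const, fun X => ?_⟩, ?_⟩
  · by_cases hX : X ∈ R <;> simp [hX]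
  refine (risk_ite_mem_le hRm (half_pos hε0).le (half_pos hε0).le ?_ ?_).trans_eq (add_halves ε)
  · rintro P ⟨ν, hν, -, hrect⟩ θ hθ
    have hprob : ∀ t, IsProbabilityMeasure (ν t) := fun t => (hν t).1
    rw [eq_pi_of_rectangles hrect]
    have hU : {E | θ + E ∈ R} = ⋃ k ∈ K, {E | θ + E ∈ D k} := by
      ext E; simp [hR]
    rw [hU]
    refine (measure_biUnion_finset_le _ _).trans ?_
    refine (Finset.sum_le_sum fun k hk =>
      (hD k (Finset.mem_filter.1 hk).2 ν hν).1 θ hθ).trans ?_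
    rw [← ENNReal.ofReal_sum_of_nonneg fun k _ => (hδ0 k).le]
    refine ENNReal.ofReal_le_ofReal (le_trans ?_ (sum_inv_mul_succ_le (ε / 2) (by linarith) n))
    exact Finset.sum_le_sum_of_subset_of_nonneg (Finset.filter_subset _ _) fun k _ _ => (hδ0 k).le
  · rintro P ⟨ν, hν, -, hrect⟩ θ hθ
    have hprob : ∀ t, IsProbabilityMeasure (ν t) := fun t => (hν t).1
    rw [eq_pi_of_rectangles hrect]
    simp only [ThetaSeq, Set.mem_iUnion, Finset.mem_Icc] at hθ
    obtain ⟨t0, ⟨ht1, ht2⟩, μ₁, μ₂, hμ₁, hμ₂, hsep⟩ := hθ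
    set τ := min t0 (n - t0) with hτ
    have hτ1 : τ ≠ 0 := by omega
    set k := Nat.log 2 τ with hk
    have hk1 : 2 ^ k ≤ τ := Nat.pow_log_le_self 2 hτ1
    have hk2 : τ < 2 ^ (k + 1) := Nat.lt_pow_succ_log_self (by norm_num) τ
    have hkn : 2 * 2 ^ k ≤ n := by omega
    have hkK : k ∈ K := by
      have := Nat.lt_two_pow_self (n := k)
      simp only [hK, Finset.mem_filter, Finset.mem_range]
      omega
    have hmono : {E | θ + E ∉ R} ⊆ {E | θ + E ∉ D k} := fun E hE hE' =>
      hE (Set.mem_biUnion hkK hE')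
    refine (measure_mono hmono).trans ?_
    refine (hD k hkn ν hν).2 θ μ₁ μ₂ t0 (by omega) (by omega) hμ₁ hμ₂ ?_
    have hc := (hρ t0 ht1 ht2).trans ((le_abs_self _).trans
      (Real.abs_le_sqrt hsep))
    have hNτ : ((2 ^ k : ℕ) : ℝ) ≤ τ := by exact_mod_cast hk1
    have hτN : (τ : ℝ) ≤ 2 * ((2 ^ k : ℕ) : ℝ) := by
      rw [pow_succ'] at hk2; exact_mod_cast hk2.le
    have h := signal_at_scale hβ0 hβ1 (by linarith : 0 ≤ C₁) (by linarith) hp (by positivity)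
      hNτ hτN (hH0 k).le (hHN k) (hHA k hkn) hℓ hc
    simpa only [hm, Nat.cast_pow, Nat.cast_ofNat] using h

end ChangePoint
end

section
/- Let α ≥ 4, K > 0, 1 ≤ s ≤ p, and set t^res := 32·(log(e²p/s) + s^{−1}·log log(8n)). For any ε ∈ (0,1) there exist a measurable test φ : ℝ^{p×n} → {0,1} and a constant C > 0 depending only on α, K and ε such that R_{P_{α,K}^⊗, res}(ρ, φ) ≤ ε as long as ρ² ≥ C·s·(log(ep/s) + log log(8n)). -/
open MeasureTheory
open scoped Classical

namespace ChangePoint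

/-- The class `𝒫_{α,K}^⊗` makes the entries of a fixed row independent, with the prescribed laws. -/
lemma IsEntrywiseProduct.measure_iInter {p n : ℕ} {P : Measure (Fin n → Fin p → ℝ)}
    {ν : Fin n → Fin p → Measure ℝ} (hν : ∀ t j, IsProbabilityMeasure (ν t j))
    (h : IsEntrywiseProduct p n P ν) (j : Fin p) (S : Finset (Fin n)) (A : Fin n → Set ℝ)
    (hA : ∀ t ∈ S, MeasurableSet (A t)) :
    P (⋂ t ∈ S, (fun x : Fin n → Fin p → ℝ => x t j) ⁻¹' A t) = ∏ t ∈ S, ν t j (A t) := by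
  have key := h.2 (fun t i => if i = j ∧ t ∈ S then A t else Set.univ) (by
    intro t i
    split_ifs with hi
    · exact hA t hi.2
    · exact MeasurableSet.univ)
  have hset : {x : Fin n → Fin p → ℝ | ∀ t i, x t i ∈ if i = j ∧ t ∈ S then A t else Set.univ} =
      ⋂ t ∈ S, (fun x : Fin n → Fin p → ℝ => x t j) ⁻¹' A t := by
    ext x
    simp only [Set.mem_ofPred_eq, Set.mem_iInter, Set.mem_preimage]
    constructor
    · intro hx t ht
      simpa [ht] using hx t j
    · intro hx t i
      split_ifs with hi
      · rw [hi.1]; exact hx t hi.2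
      · trivial
  rw [hset] at key
  rw [key]
  have h1 : ∀ t, ∏ i, ν t i (if i = j ∧ t ∈ S then A t else Set.univ) =
      if t ∈ S then ν t j (A t) else 1 := by
    intro t
    rw [Finset.prod_eq_single j]
    · by_cases ht : t ∈ S <;> simp [ht]
    · intro i _ hi
      simp [hi]
    · simp
  simp only [h1, Finset.prod_ite_mem, Finset.univ_inter]

lemma IsEntrywiseProduct.map_eval {p n : ℕ} {P : Measure (Fin n → Fin p → ℝ)}
    {ν : Fin n → Fin p → Measure ℝ} (hν : ∀ t j, IsProbabilityMeasure (ν t j))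
    (h : IsEntrywiseProduct p n P ν) (t : Fin n) (j : Fin p) :
    P.map (fun x => x t j) = ν t j := by
  ext A hA
  rw [Measure.map_apply (by fun_prop) hA]
  simpa using h.measure_iInter hν j {t} (fun _ => A) (fun _ _ => hA)

lemma IsEntrywiseProduct.iIndepFun {p n : ℕ} {P : Measure (Fin n → Fin p → ℝ)}
    {ν : Fin n → Fin p → Measure ℝ} (hν : ∀ t j, IsProbabilityMeasure (ν t j))
    (h : IsEntrywiseProduct p n P ν) (j : Fin p) :
    ProbabilityTheory.iIndepFun (fun t (x : Fin n → Fin p → ℝ) => x t j) P := by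
  rw [ProbabilityTheory.iIndepFun_iff_measure_inter_preimage_eq_mul]
  intro S A hA
  rw [h.measure_iInter hν j S A hA]
  refine Finset.prod_congr rfl fun t ht => ?_
  rw [← h.map_eval hν t j, Measure.map_apply (by fun_prop) (hA t ht)]

/-- Centered unit-variance independent real random variables. -/
structure IsWhite {Ω : Type*} [MeasurableSpace Ω] {ι : Type*} (ξ : ι → Ω → ℝ)
    (P : Measure Ω) : Prop where
  measurable : ∀ t, Measurable (ξ t)
  indep : ProbabilityTheory.iIndepFun ξ P
  memLp : ∀ t, MemLp (ξ t) 2 P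
  mean : ∀ t, ∫ ω, ξ t ω ∂P = 0
  sq : ∀ t, ∫ ω, ξ t ω ^ 2 ∂P = 1

lemma isWhite_of_mem_Pclass {p n : ℕ} {α K : ℝ} {P : Measure (Fin n → Fin p → ℝ)}
    (hP : P ∈ Pclass p n α K) :
    IsProbabilityMeasure P ∧ ∀ j, IsWhite (fun t (x : Fin n → Fin p → ℝ) => x t j) P := by
  obtain ⟨ν, hν, h⟩ := hP
  have hpr : ∀ t j, IsProbabilityMeasure (ν t j) := fun t j => (hν t j).1
  refine ⟨h.1, fun j => ⟨fun t => by fun_prop, h.iIndepFun hpr j, fun t => ?_, fun t => ?_,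
    fun t => ?_⟩⟩
  · have h2 : MemLp (fun x : ℝ => x) 2 (ν t j) := by
      rw [memLp_two_iff_integrable_sq (by fun_prop)]
      refine ⟨by fun_prop, ?_⟩
      rw [hasFiniteIntegral_iff_ofReal (ae_of_all _ fun x => sq_nonneg x), (hν t j).2.2.2.1]
      exact ENNReal.one_lt_top
    rw [← h.map_eval hpr t j] at h2
    exact h2.comp_of_map (Measurable.aemeasurable (by fun_prop))
  · have := (hν t j).2.2.1
    rw [← h.map_eval hpr t j, integral_map (Measurable.aemeasurable (by fun_prop)) (by fun_prop)] at this
    exact this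
  · have h2 : ∫ x, x ^ 2 ∂(ν t j) = 1 := by
      rw [integral_eq_lintegral_of_nonneg_ae (ae_of_all _ fun x => sq_nonneg x) (by fun_prop),
        (hν t j).2.2.2.1]
      rfl
    rw [← h.map_eval hpr t j, integral_map (Measurable.aemeasurable (by fun_prop)) (by fun_prop)] at h2
    exact h2

section White

variable {Ω : Type*} [MeasurableSpace Ω] {ι : Type*} [Fintype ι] {ξ : ι → Ω → ℝ} {P : Measure Ω}

lemma IsWhite.memLp_sum (h : IsWhite ξ P) (w : ι → ℝ) :
    MemLp (fun ω => ∑ t, w t * ξ t ω) 2 P :=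
  memLp_finsetSum _ fun t _ => (h.memLp t).const_mul (w t)

lemma IsWhite.integrable_sq (h : IsWhite ξ P) (w : ι → ℝ) :
    Integrable (fun ω => (∑ t, w t * ξ t ω) ^ 2) P :=
  (h.memLp_sum w).integrable_sq

lemma IsWhite.integral_sq [IsProbabilityMeasure P] (h : IsWhite ξ P) (w : ι → ℝ) :
    ∫ ω, (∑ t, w t * ξ t ω) ^ 2 ∂P = ∑ t, w t ^ 2 := by
  have hmean : ∫ ω, (∑ t, w t * ξ t ω) ∂P = 0 := by
    rw [integral_finsetSum _ fun t _ => ((h.memLp t).integrable (by norm_num)).const_mul _]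
    simp [integral_const_mul, h.mean]
  have hfun : (∑ t, fun ω => w t * ξ t ω) = fun ω => ∑ t, w t * ξ t ω := by
    funext ω
    simp
  have hvar := ProbabilityTheory.IndepFun.variance_sum (μ := P)
    (X := fun t ω => w t * ξ t ω) (s := Finset.univ)
    (fun t _ => (h.memLp t).const_mul (w t))
    (fun t _ u _ htu => (h.indep.indepFun htu).comp (φ := fun x => w t * x)
      (ψ := fun x => w u * x) (by fun_prop) (by fun_prop))
  rw [ProbabilityTheory.variance_of_integral_eq_zero
    (by rw [hfun]; exact (h.memLp_sum w).aestronglyMeasurable.aemeasurable)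
    (by rw [hfun]; exact hmean), hfun] at hvar
  rw [hvar]
  refine Finset.sum_congr rfl fun t _ => ?_
  rw [ProbabilityTheory.variance_const_mul, ProbabilityTheory.variance_of_integral_eq_zero
    (h.measurable t).aemeasurable (h.mean t), h.sq, mul_one]

/-- Linear combinations with disjoint supports and bounded energy: the product of the `1 + Y_g²`
has mean at most `2` to the number of factors. -/
lemma IsWhite.prod_one_add_sq [IsProbabilityMeasure P] (h : IsWhite ξ P) {κ : Type*}
    (w : κ → ι → ℝ) (hw : ∀ g, ∑ t, w g t ^ 2 ≤ 1)
    (hdisj : ∀ g g' t, g ≠ g' → w g t = 0 ∨ w g' t = 0) (Γ : Finset κ) :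
    Integrable (fun ω => ∏ g ∈ Γ, (1 + (∑ t, w g t * ξ t ω) ^ 2)) P ∧
      ∫ ω, ∏ g ∈ Γ, (1 + (∑ t, w g t * ξ t ω) ^ 2) ∂P ≤ 2 ^ Γ.card := by
  classical
  induction Γ using Finset.induction_on with
  | empty => simp
  | insert g Γ hg ih =>
    set F : Ω → ℝ := fun ω => 1 + (∑ t, w g t * ξ t ω) ^ 2 with hF
    set H : Ω → ℝ := fun ω => ∏ g ∈ Γ, (1 + (∑ t, w g t * ξ t ω) ^ 2) with hH
    have hFint : Integrable F P := (integrable_const 1).add (h.integrable_sq (w g))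
    have hFle : ∫ ω, F ω ∂P ≤ 2 := by
      rw [hF, integral_add (integrable_const 1) (h.integrable_sq (w g)), h.integral_sq]
      simp only [integral_const, probReal_univ, smul_eq_mul]
      linarith [hw g]
    have hF0 : 0 ≤ ∫ ω, F ω ∂P := integral_nonneg fun ω => by positivity
    set A : Finset ι := Finset.univ.filter fun t => w g t ≠ 0 with hA
    set B : Finset ι := Finset.univ.filter fun t => w g t = 0 with hB
    have hAB : Disjoint A B := by
      rw [Finset.disjoint_left]
      intro t h1 h2
      simp only [hA, hB, Finset.mem_filter, Finset.mem_univ, true_and] at h1 h2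
      exact h1 h2
    have hind := h.indep.indepFun_finset A B hAB h.measurable
    have hind2 : ProbabilityTheory.IndepFun F H P := by
      have := hind.comp
        (φ := fun x : A → ℝ => 1 + (∑ t : A, w g t * x t) ^ 2)
        (ψ := fun x : B → ℝ => ∏ g' ∈ Γ, (1 + (∑ t : B, w g' t * x t) ^ 2))
        (by fun_prop) (by fun_prop)
      convert this using 1
      · funext ω
        simp only [hF, Function.comp_apply]
        rw [Finset.sum_coe_sort A (fun t => w g t * ξ t ω), hA, Finset.sum_filter]
        congr 2
        refine Finset.sum_congr rfl fun t _ => ?_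
        by_cases ht : w g t = 0 <;> simp [ht]
      · funext ω
        simp only [hH, Function.comp_apply]
        refine Finset.prod_congr rfl fun g' hg' => ?_
        rw [Finset.sum_coe_sort B (fun t => w g' t * ξ t ω), hB, Finset.sum_filter]
        congr 2
        refine Finset.sum_congr rfl fun t _ => ?_
        have hne : g ≠ g' := fun e => hg (e ▸ hg')
        rcases hdisj g g' t hne with ht | ht
        · simp [ht]
        · simp [ht]
    have hprod : (fun ω => ∏ g ∈ insert g Γ, (1 + (∑ t, w g t * ξ t ω) ^ 2)) = F * H := by
      funext ω
      simp only [Finset.prod_insert hg, Pi.mul_apply, hF, hH]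
    rw [hprod]
    refine ⟨hind2.integrable_mul hFint ih.1, ?_⟩
    rw [hind2.integral_mul_eq_mul_integral hFint.aestronglyMeasurable ih.1.aestronglyMeasurable,
      Finset.card_insert_of_notMem hg, pow_succ']
    exact mul_le_mul hFle ih.2 (integral_nonneg fun ω => by positivity) (by norm_num)

end White

noncomputable section Stat

/-- Weights of the `g`-th block contrast: the block of `b` observations number `g` from the left,
minus its mirror image, normalized to unit energy. -/
def contrast (n b g : ℕ) (t : Fin n) : ℝ :=
  ((if (t : ℕ) / b = g then 1 else 0) - (if (Fin.rev t : ℕ) / b = g then 1 else 0)) /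
    Real.sqrt (2 * b)

/-- The `g`-th block contrast of the `j`-th row. -/
def blockStat (p n b g : ℕ) (X : Fin n → Fin p → ℝ) (j : Fin p) : ℝ :=
  ∑ t, contrast n b g t * X t j

/-- Harmonic mean over `G` blocks of `1 + Y_g(j)²`. -/
def harmonicStat (p n b G : ℕ) (X : Fin n → Fin p → ℝ) (j : Fin p) : ℝ :=
  ((∑ g ∈ Finset.range G, (1 + blockStat p n b g X j ^ 2)⁻¹) / G)⁻¹

/-- Total excess over the level `c` of the coordinatewise harmonic means. -/
def excessStat (p n b G : ℕ) (c : ℝ) (X : Fin n → Fin p → ℝ) : ℝ :=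
  ∑ j, max (harmonicStat p n b G X j - c) 0

lemma sum_block_indicator {n b g : ℕ} (hb : 0 < b) (h : (g + 1) * b ≤ n) :
    ∑ t : Fin n, (if (t : ℕ) / b = g then (1 : ℝ) else 0) = b := by
  rw [Fin.sum_univ_eq_sum_range (fun t => if t / b = g then (1 : ℝ) else 0) n,
    Finset.sum_boole]
  have : (Finset.range n).filter (fun t => t / b = g) = Finset.Ico (g * b) ((g + 1) * b) := by
    ext t
    simp only [Finset.mem_filter, Finset.mem_range, Finset.mem_Ico]
    rw [Nat.div_eq_iff hb, add_mul, one_mul]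
    rw [add_mul, one_mul] at h
    omega
  rw [this, Nat.card_Ico, add_mul, one_mul, Nat.add_sub_cancel_left]

lemma sum_block_indicator_rev {n b g : ℕ} (hb : 0 < b) (h : (g + 1) * b ≤ n) :
    ∑ t : Fin n, (if (Fin.rev t : ℕ) / b = g then (1 : ℝ) else 0) = b := by
  rw [← sum_block_indicator hb h]
  exact Equiv.sum_comp Fin.revPerm fun t : Fin n => if (t : ℕ) / b = g then (1 : ℝ) else 0

lemma sum_contrast {n b g : ℕ} (hb : 0 < b) (h : (g + 1) * b ≤ n) :
    ∑ t, contrast n b g t = 0 := by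
  simp only [contrast]
  rw [← Finset.sum_div, Finset.sum_sub_distrib, sum_block_indicator hb h,
    sum_block_indicator_rev hb h, sub_self, zero_div]

lemma sum_contrast_sq_le {n b g : ℕ} (hb : 0 < b) (h : (g + 1) * b ≤ n) :
    ∑ t, contrast n b g t ^ 2 ≤ 1 := by
  have hb' : (0 : ℝ) < b := by exact_mod_cast hb
  have hle : ∀ t : Fin n, contrast n b g t ^ 2 ≤
      ((if (t : ℕ) / b = g then 1 else 0) + (if (Fin.rev t : ℕ) / b = g then 1 else 0)) /
        (2 * b) := by
    intro t
    rw [contrast, div_pow, Real.sq_sqrt (by positivity)]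
    gcongr
    split_ifs <;> norm_num
  refine (Finset.sum_le_sum fun t _ => hle t).trans ?_
  rw [← Finset.sum_div, Finset.sum_add_distrib, sum_block_indicator hb h,
    sum_block_indicator_rev hb h, div_le_one (by positivity)]
  linarith

lemma contrast_disjoint {n b G g g' : ℕ} (hb : 0 < b) (hn : 2 * (b * G) ≤ n) (hg : g < G)
    (hg' : g' < G) (hne : g ≠ g') (t : Fin n) : contrast n b g t = 0 ∨ contrast n b g' t = 0 := by
  have hlt : ∀ m h : ℕ, h < G → m / b = h → m < b * G := by
    intro m h hh hm
    have := (Nat.div_lt_iff_lt_mul hb).1 (hm.trans_lt hh)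
    rwa [mul_comm] at this
  have hrev := Fin.val_rev t
  have htn := t.2
  by_contra hcon
  push Not at hcon
  obtain ⟨h1, h2⟩ := hcon
  have h1' : (t : ℕ) / b = g ∨ (Fin.rev t : ℕ) / b = g := by
    by_contra hh
    push Not at hh
    exact h1 (by simp [contrast, hh.1, hh.2, -Fin.val_rev])
  have h2' : (t : ℕ) / b = g' ∨ (Fin.rev t : ℕ) / b = g' := by
    by_contra hh
    push Not at hh
    exact h2 (by simp [contrast, hh.1, hh.2, -Fin.val_rev])
  rcases h1' with e1 | e1 <;> rcases h2' with e2 | e2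
  · exact hne (e1.symm.trans e2)
  · have := hlt _ _ hg e1
    have := hlt _ _ hg' e2
    omega
  · have := hlt _ _ hg e1
    have := hlt _ _ hg' e2
    omega
  · exact hne (e1.symm.trans e2)

/-- Response of a block contrast to a mean change away from the blocks. -/
lemma blockStat_change {p n b G g t0 : ℕ} (hb : 0 < b) (hg : g < G) (h1 : b * G ≤ t0)
    (h2 : t0 + b * G ≤ n) {θ : Fin n → Fin p → ℝ} {μ₁ μ₂ : Fin p → ℝ}
    (hθ₁ : ∀ t : Fin n, (t : ℕ) < t0 → θ t = μ₁) (hθ₂ : ∀ t : Fin n, t0 ≤ (t : ℕ) → θ t = μ₂)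
    (j : Fin p) : blockStat p n b g θ j = b / Real.sqrt (2 * b) * (μ₁ j - μ₂ j) := by
  have hgb : (g + 1) * b ≤ n := by
    have : (g + 1) * b ≤ G * b := Nat.mul_le_mul_right b hg
    rw [mul_comm G b] at this
    omega
  have hlt : ∀ m : ℕ, m / b = g → m < b * G := by
    intro m hm
    have := (Nat.div_lt_iff_lt_mul hb).1 (hm.trans_lt hg)
    rwa [mul_comm] at this
  have hterm : ∀ t : Fin n, contrast n b g t * θ t j =
      ((if (t : ℕ) / b = g then 1 else 0) * μ₁ j -
        (if (Fin.rev t : ℕ) / b = g then 1 else 0) * μ₂ j) / Real.sqrt (2 * b) := by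
    intro t
    have hrev := Fin.val_rev t
    have htn := t.2
    rw [contrast]
    by_cases e1 : (t : ℕ) / b = g
    · have l1 := hlt _ e1
      rw [hθ₁ t (by omega)]
      have e2 : (Fin.rev t : ℕ) / b ≠ g := fun e2 => by
        have := hlt _ e2
        omega
      simp only [e1, e2, if_true, if_false]
      ring
    · by_cases e2 : (Fin.rev t : ℕ) / b = g
      · have l2 := hlt _ e2
        rw [hθ₂ t (by omega)]
        simp only [e1, e2, if_true, if_false]
        ring
      · simp [e1, e2, -Fin.val_rev]
  rw [blockStat, Finset.sum_congr rfl fun t _ => hterm t, ← Finset.sum_div,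
    Finset.sum_sub_distrib, ← Finset.sum_mul, ← Finset.sum_mul, sum_block_indicator hb hgb,
    sum_block_indicator_rev hb hgb]
  ring

lemma blockStat_add (p n b g : ℕ) (X Y : Fin n → Fin p → ℝ) (j : Fin p) :
    blockStat p n b g (X + Y) j = blockStat p n b g X j + blockStat p n b g Y j := by
  simp [blockStat, mul_add, Finset.sum_add_distrib]

lemma blockStat_const {p n b g : ℕ} (hb : 0 < b) (h : (g + 1) * b ≤ n) {θ : Fin n → Fin p → ℝ}
    {μ : Fin p → ℝ} (hθ : ∀ t, θ t = μ) (j : Fin p) : blockStat p n b g θ j = 0 := by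
  simp [blockStat, hθ, ← Finset.sum_mul, sum_contrast hb h]

lemma harmonicStat_inv (p n b G : ℕ) (X : Fin n → Fin p → ℝ) (j : Fin p) :
    (harmonicStat p n b G X j)⁻¹ =
      (∑ g ∈ Finset.range G, (1 + blockStat p n b g X j ^ 2)⁻¹) / G := by
  rw [harmonicStat, inv_inv]

lemma harmonicStat_pos {p n b G : ℕ} (hG : 0 < G) (X : Fin n → Fin p → ℝ) (j : Fin p) :
    0 < harmonicStat p n b G X j := by
  rw [harmonicStat]
  have : 0 < ∑ g ∈ Finset.range G, (1 + blockStat p n b g X j ^ 2)⁻¹ :=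
    Finset.sum_pos (fun g _ => by positivity) ⟨0, by simpa using hG⟩
  positivity

/-- The harmonic mean is at most the geometric mean. -/
lemma harmonicStat_pow_le {p n b G : ℕ} (hG : 0 < G) (X : Fin n → Fin p → ℝ) (j : Fin p) :
    harmonicStat p n b G X j ^ G ≤ ∏ g ∈ Finset.range G, (1 + blockStat p n b g X j ^ 2) := by
  have hG' : (G : ℝ) ≠ 0 := by exact_mod_cast hG.ne'
  have hx : ∀ g ∈ Finset.range G, 0 ≤ (1 + blockStat p n b g X j ^ 2)⁻¹ :=
    fun g _ => by positivity
  have h := Real.geom_mean_le_arith_mean (Finset.range G) (fun _ => 1)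
    (fun g => (1 + blockStat p n b g X j ^ 2)⁻¹) (fun _ _ => zero_le_one)
    (by simpa using hG) hx
  simp only [Real.rpow_one, Finset.sum_const, Finset.card_range, nsmul_eq_mul, mul_one,
    one_mul] at h
  have hprod : 0 ≤ ∏ g ∈ Finset.range G, (1 + blockStat p n b g X j ^ 2)⁻¹ :=
    Finset.prod_nonneg hx
  have h2 := pow_le_pow_left₀ (Real.rpow_nonneg hprod _) h G
  rw [Real.rpow_inv_natCast_pow hprod hG.ne', ← harmonicStat_inv, Finset.prod_inv_distrib,
    inv_pow] at h2
  exact (inv_le_inv₀ (Finset.prod_pos fun g _ => by positivity)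
    (pow_pos (harmonicStat_pos hG X j) G)).1 h2

lemma measurable_blockStat (p n b g : ℕ) (j : Fin p) :
    Measurable fun X : Fin n → Fin p → ℝ => blockStat p n b g X j := by
  unfold blockStat
  fun_prop

lemma measurable_excessStat (p n b G : ℕ) (c : ℝ) : Measurable (excessStat p n b G c) := by
  unfold excessStat harmonicStat
  have := fun g => measurable_blockStat p n b g
  fun_prop

/-- Pointwise bound behind the control of the type I error. -/
lemma excessStat_le {p n b G : ℕ} (hG : 0 < G) {c : ℝ} (hc : 0 < c) (X : Fin n → Fin p → ℝ) :
    excessStat p n b G c X ≤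
      ∑ j, c * c⁻¹ ^ G * ∏ g ∈ Finset.range G, (1 + blockStat p n b g X j ^ 2) := by
  refine Finset.sum_le_sum fun j _ => max_le ?_ ?_
  · have hH := harmonicStat_pos (b := b) hG X j
    have h1 : harmonicStat p n b G X j - c ≤ c * c⁻¹ ^ G * harmonicStat p n b G X j ^ G := by
      rw [mul_assoc, ← mul_pow]
      set H := harmonicStat p n b G X j
      rcases le_or_gt H c with hle | hlt
      · have : 0 ≤ c * (c⁻¹ * H) ^ G := by positivity
        linarith
      · have h1 : 1 ≤ c⁻¹ * H := by
          rw [inv_mul_eq_div, one_le_div hc]; exact hlt.le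
        have h2 := le_self_pow₀ h1 hG.ne'
        have h3 : c * (c⁻¹ * H) ≤ c * (c⁻¹ * H) ^ G := by gcongr
        rw [mul_inv_cancel_left₀ hc.ne'] at h3
        linarith
    refine h1.trans ?_
    gcongr
    exact harmonicStat_pow_le hG X j
  · have : 0 ≤ ∏ g ∈ Finset.range G, (1 + blockStat p n b g X j ^ 2) :=
      Finset.prod_nonneg fun g _ => by positivity
    positivity

/-- Pointwise bound behind the control of the type II error. -/
lemma sq_sum_le_of_excessStat_le {p n b G s : ℕ} (hG : 0 < G) {c M : ℝ} (hc : 0 < c)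
    {X N : Fin n → Fin p → ℝ} {m : Fin p → ℝ} (hsupp : (Finset.univ.filter (m · ≠ 0)).card ≤ s)
    (hX : ∀ g < G, ∀ j, blockStat p n b g X j = m j + blockStat p n b g N j)
    (hM : M = ∑ j, m j ^ 2) (hs : excessStat p n b G c X ≤ s) :
    M ^ 2 ≤ (s * (1 + c)) *
      ∑ j, m j ^ 2 * (2 / G * ∑ g ∈ Finset.range G, (1 + blockStat p n b g N j ^ 2)) := by
  set S := Finset.univ.filter (m · ≠ 0) with hS
  have hG' : (0 : ℝ) < G := by exact_mod_cast hG
  have hMS : M = ∑ j ∈ S, m j ^ 2 := by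
    rw [hM, hS, Finset.sum_filter]
    refine Finset.sum_congr rfl fun j _ => ?_
    by_cases h : m j = 0 <;> simp [h]
  have hH : ∑ j ∈ S, harmonicStat p n b G X j ≤ s * (1 + c) := by
    have h1 : ∑ j ∈ S, (harmonicStat p n b G X j - c) ≤ s :=
      calc ∑ j ∈ S, (harmonicStat p n b G X j - c)
          ≤ ∑ j ∈ S, max (harmonicStat p n b G X j - c) 0 :=
            Finset.sum_le_sum fun j _ => le_max_left _ _
        _ ≤ excessStat p n b G c X :=
            Finset.sum_le_univ_sum_of_nonneg fun j => le_max_right _ _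
        _ ≤ s := hs
    rw [Finset.sum_sub_distrib, Finset.sum_const, nsmul_eq_mul] at h1
    have h2 : (S.card : ℝ) * c ≤ s * c := by gcongr
    linarith
  have hCS : M ^ 2 ≤ (∑ j ∈ S, harmonicStat p n b G X j) *
      ∑ j ∈ S, m j ^ 2 * (m j ^ 2 * (harmonicStat p n b G X j)⁻¹) := by
    rw [hMS]
    refine Finset.sum_sq_le_sum_mul_sum_of_sq_le_mul S
      (fun j _ => (harmonicStat_pos hG X j).le) (fun j _ => ?_) (fun j _ => ?_)
    · have := harmonicStat_pos (b := b) hG X j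
      positivity
    · have := (harmonicStat_pos (b := b) hG X j).ne'
      refine le_of_eq ?_
      field_simp
  refine hCS.trans (mul_le_mul hH ?_ ?_ (by positivity))
  · refine (Finset.sum_le_sum fun j _ => ?_).trans
      (Finset.sum_le_univ_sum_of_nonneg fun j => by positivity)
    refine mul_le_mul_of_nonneg_left ?_ (sq_nonneg _)
    rw [harmonicStat_inv, mul_div_assoc', div_mul_eq_mul_div, Finset.mul_sum, Finset.mul_sum]
    refine div_le_div_of_nonneg_right (Finset.sum_le_sum fun g hg => ?_) hG'.le
    rw [hX g (Finset.mem_range.1 hg) j, ← div_eq_mul_inv, div_le_iff₀ (by positivity)]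
    set x := m j
    set y := blockStat p n b g N j
    nlinarith [sq_nonneg (x + 2 * y), sq_nonneg (y * (x + y)), sq_nonneg y, sq_nonneg (x + y)]
  · refine Finset.sum_nonneg fun j _ => ?_
    have := harmonicStat_pos (b := b) hG X j
    positivity

end Stat

section Test

/-- Number of blocks used at scale `2 ^ k`. -/
noncomputable def numBlocks (p n s k : ℕ) : ℕ :=
  min (2 ^ k) (⌈Real.log (Real.exp 1 * (p : ℝ) / (s : ℝ)) + LL n⌉₊ + 2)

/-- Block length used at scale `2 ^ k`. -/
noncomputable def blockLen (p n s k : ℕ) : ℕ := 2 ^ k / numBlocks p n s k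

/-- The scales (exponents of two) scanned by the test. -/
noncomputable def scales (p n s : ℕ) : Finset ℕ :=
  (Finset.range (Nat.log 2 n)).filter fun k =>
    2 * Real.log (Real.exp 1 * (p : ℝ) / (s : ℝ)) ≤ 2 ^ k

/-- The scan test based on the excess of harmonic means. -/
noncomputable def scanTest (p n s : ℕ) (c : ℝ) (X : Fin n → Fin p → ℝ) : ℝ :=
  if ∃ k ∈ scales p n s,
    (s : ℝ) < excessStat p n (blockLen p n s k) (numBlocks p n s k) c X then 1 else 0

lemma isTest_scanTest (p n s : ℕ) (c : ℝ) : IsTest p n (scanTest p n s c) := by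
  refine ⟨?_, fun x => ?_⟩
  · refine Measurable.ite ?_ measurable_const measurable_const
    have : {X : Fin n → Fin p → ℝ | ∃ k ∈ scales p n s,
        (s : ℝ) < excessStat p n (blockLen p n s k) (numBlocks p n s k) c X} =
        ⋃ k ∈ scales p n s, {X | (s : ℝ) <
          excessStat p n (blockLen p n s k) (numBlocks p n s k) c X} := by
      ext X
      simp
    rw [this]
    exact Finset.measurableSet_biUnion _ fun k _ =>
      measurableSet_lt measurable_const (measurable_excessStat _ _ _ _ _)
  · rw [scanTest]
    split_ifs <;> simp

lemma one_le_numBlocks (p n s k : ℕ) : 1 ≤ numBlocks p n s k :=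
  le_min Nat.one_le_two_pow (by omega)

lemma one_le_blockLen (p n s k : ℕ) : 1 ≤ blockLen p n s k :=
  (Nat.one_le_div_iff (one_le_numBlocks p n s k)).2 (min_le_left _ _)

lemma blockLen_mul_numBlocks_le (p n s k : ℕ) : blockLen p n s k * numBlocks p n s k ≤ 2 ^ k :=
  Nat.div_mul_le_self _ _

lemma le_two_mul_blockLen_mul_numBlocks (p n s k : ℕ) :
    2 ^ k ≤ 2 * (blockLen p n s k * numBlocks p n s k) := by
  have h := Nat.lt_div_mul_add (a := 2 ^ k) (one_le_numBlocks p n s k)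
  have h1 : 1 * numBlocks p n s k ≤ blockLen p n s k * numBlocks p n s k :=
    Nat.mul_le_mul_right _ (one_le_blockLen p n s k)
  rw [blockLen] at *
  omega

lemma two_mul_two_pow_le {n k : ℕ} (hk : k < Nat.log 2 n) : 2 * 2 ^ k ≤ n := by
  rw [← pow_succ']
  exact (Nat.pow_le_pow_right (by norm_num) hk).trans
    (Nat.pow_log_le_self 2 (by rintro rfl; simp at hk))

/-- Mean of the product of block energies under pure noise. -/
lemma prod_blockStat_noise {p n b G : ℕ} (hb : 0 < b) (hn : 2 * (b * G) ≤ n)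
    {P : Measure (Fin n → Fin p → ℝ)} [IsProbabilityMeasure P] {j : Fin p}
    (h : IsWhite (fun t (x : Fin n → Fin p → ℝ) => x t j) P) :
    Integrable (fun E => ∏ g ∈ Finset.range G, (1 + blockStat p n b g E j ^ 2)) P ∧
      ∫ E, ∏ g ∈ Finset.range G, (1 + blockStat p n b g E j ^ 2) ∂P ≤ 2 ^ G := by
  have hgb : ∀ g : Fin G, ((g : ℕ) + 1) * b ≤ n := fun g => by
    have : ((g : ℕ) + 1) * b ≤ G * b := Nat.mul_le_mul_right b g.2
    rw [mul_comm G b] at this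
    omega
  have key := h.prod_one_add_sq (fun (g : Fin G) t => contrast n b g t)
    (fun g => sum_contrast_sq_le hb (hgb g))
    (fun g g' t hne => contrast_disjoint hb hn g.2 g'.2 (fun e => hne (Fin.ext e)) t)
    Finset.univ
  have e : ∀ E : Fin n → Fin p → ℝ, ∏ g : Fin G, (1 + (∑ t, contrast n b g t * E t j) ^ 2) =
      ∏ g ∈ Finset.range G, (1 + blockStat p n b g E j ^ 2) := fun E =>
    Fin.prod_univ_eq_prod_range (fun g => 1 + blockStat p n b g E j ^ 2) G
  simpa only [e, Finset.card_univ, Fintype.card_fin] using key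

lemma integral_scanTest_null_le {p n s : ℕ} (hs : 1 ≤ s) {c : ℝ} (hc : 0 < c)
    {P : Measure (Fin n → Fin p → ℝ)} [IsProbabilityMeasure P]
    (h : ∀ j, IsWhite (fun t (x : Fin n → Fin p → ℝ) => x t j) P)
    {θ : Fin n → Fin p → ℝ} (hθ : θ ∈ Theta0 p n) :
    ∫ E, scanTest p n s c (θ + E) ∂P ≤
      ∑ k ∈ scales p n s, (p : ℝ) / s * (c * (2 / c) ^ numBlocks p n s k) := by
  obtain ⟨μ, hμ⟩ := hθ
  have hs' : (0 : ℝ) < s := by exact_mod_cast hs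
  set F : ℕ → Fin p → (Fin n → Fin p → ℝ) → ℝ := fun k j E =>
    ∏ g ∈ Finset.range (numBlocks p n s k), (1 + blockStat p n (blockLen p n s k) g E j ^ 2)
    with hF
  have hF0 : ∀ k j E, 0 ≤ F k j E := fun k j E => Finset.prod_nonneg fun g _ => by positivity
  have hbG : ∀ k ∈ scales p n s, 2 * (blockLen p n s k * numBlocks p n s k) ≤ n := by
    intro k hk
    have h1 := two_mul_two_pow_le (Finset.mem_range.1 (Finset.mem_filter.1 hk).1)
    have h2 := blockLen_mul_numBlocks_le p n s k
    omega
  have hnoise := fun k (hk : k ∈ scales p n s) j =>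
    prod_blockStat_noise (one_le_blockLen p n s k) (hbG k hk) (h j)
  set B : (Fin n → Fin p → ℝ) → ℝ := fun E =>
    ∑ k ∈ scales p n s, ∑ j, (c * c⁻¹ ^ numBlocks p n s k / s) * F k j E with hB
  have hBint : Integrable B P :=
    integrable_finsetSum _ fun k hk => integrable_finsetSum _ fun j _ =>
      (hnoise k hk j).1.const_mul _
  have hle : ∀ E, scanTest p n s c (θ + E) ≤ B E := by
    intro E
    have hB0 : ∀ k ∈ scales p n s,
        0 ≤ ∑ j, (c * c⁻¹ ^ numBlocks p n s k / s) * F k j E := fun k _ =>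
      Finset.sum_nonneg fun j _ => mul_nonneg (by positivity) (hF0 k j E)
    rw [scanTest]
    split_ifs with hex
    · obtain ⟨k, hk, hlt⟩ := hex
      refine le_trans ?_ (Finset.single_le_sum hB0 hk)
      have h1 := hlt.le.trans (excessStat_le (one_le_numBlocks p n s k) hc (θ + E))
      have h2 : ∀ g ∈ Finset.range (numBlocks p n s k), ∀ j,
          blockStat p n (blockLen p n s k) g (θ + E) j =
            blockStat p n (blockLen p n s k) g E j := by
        intro g hg j
        rw [blockStat_add, blockStat_const (one_le_blockLen p n s k) ?_ hμ, zero_add]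
        have h3 : (g + 1) * blockLen p n s k ≤ numBlocks p n s k * blockLen p n s k :=
          Nat.mul_le_mul_right _ (Finset.mem_range.1 hg)
        have h4 := hbG k hk
        rw [mul_comm (blockLen p n s k)] at h4
        omega
      have h5 : ∀ j, ∏ g ∈ Finset.range (numBlocks p n s k),
          (1 + blockStat p n (blockLen p n s k) g (θ + E) j ^ 2) = F k j E := fun j =>
        Finset.prod_congr rfl fun g hg => by rw [h2 g hg j]
      simp only [h5] at h1
      simp only [div_mul_eq_mul_div, ← Finset.sum_div]
      rwa [one_le_div hs']
    · exact Finset.sum_nonneg hB0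
  have hnn : ∀ E, 0 ≤ scanTest p n s c (θ + E) := by
    intro E
    rw [scanTest]
    split_ifs <;> norm_num
  refine (integral_mono_of_nonneg (ae_of_all _ hnn) hBint (ae_of_all _ hle)).trans ?_
  rw [hB, integral_finsetSum _ fun k hk => integrable_finsetSum _ fun j _ =>
      (hnoise k hk j).1.const_mul _]
  refine Finset.sum_le_sum fun k hk => ?_
  rw [integral_finsetSum _ fun j _ => (hnoise k hk j).1.const_mul _]
  calc ∑ j, ∫ E, c * c⁻¹ ^ numBlocks p n s k / s * F k j E ∂P
      ≤ ∑ _j : Fin p, c * c⁻¹ ^ numBlocks p n s k / s * 2 ^ numBlocks p n s k := by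
        refine Finset.sum_le_sum fun j _ => ?_
        rw [integral_const_mul]
        exact mul_le_mul_of_nonneg_left (hnoise k hk j).2 (by positivity)
    _ = (p : ℝ) / s * (c * (2 / c) ^ numBlocks p n s k) := by
        rw [Finset.sum_const, Finset.card_univ, Fintype.card_fin, nsmul_eq_mul, div_pow, inv_pow]
        ring

lemma integral_one_sub_scanTest_le {p n s k t0 : ℕ} (hk : k ∈ scales p n s) {c : ℝ}
    (hc : 0 < c) {P : Measure (Fin n → Fin p → ℝ)} [IsProbabilityMeasure P]
    (h : ∀ j, IsWhite (fun t (x : Fin n → Fin p → ℝ) => x t j) P)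
    {θ : Fin n → Fin p → ℝ} {μ₁ μ₂ : Fin p → ℝ} (h1 : 2 ^ k ≤ t0) (h2 : t0 + 2 ^ k ≤ n)
    (hθ₁ : ∀ t : Fin n, (t : ℕ) < t0 → θ t = μ₁) (hθ₂ : ∀ t : Fin n, t0 ≤ (t : ℕ) → θ t = μ₂)
    (hsp : l0 p (fun j => μ₁ j - μ₂ j) ≤ s) {M : ℝ} (hM0 : 0 < M)
    (hM : M = blockLen p n s k / 2 * sqnorm p (fun j => μ₁ j - μ₂ j)) :
    ∫ E, (1 - scanTest p n s c (θ + E)) ∂P ≤ 4 * (s * (1 + c)) / M := by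
  set b := blockLen p n s k with hbdef
  set G := numBlocks p n s k with hGdef
  have hb : 0 < b := one_le_blockLen p n s k
  have hb' : (0 : ℝ) < b := by exact_mod_cast hb
  have hG : 0 < G := one_le_numBlocks p n s k
  have hG' : (0 : ℝ) < G := by exact_mod_cast hG
  have hbG : b * G ≤ 2 ^ k := blockLen_mul_numBlocks_le p n s k
  set m : Fin p → ℝ := fun j => b / Real.sqrt (2 * b) * (μ₁ j - μ₂ j) with hm
  have hsq : (b / Real.sqrt (2 * b)) ^ 2 = (b : ℝ) / 2 := by
    rw [div_pow, Real.sq_sqrt (by positivity)]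
    field_simp
  have hMm : M = ∑ j, m j ^ 2 := by
    rw [hM, sqnorm, Finset.mul_sum]
    refine Finset.sum_congr rfl fun j _ => ?_
    rw [hm]
    simp only
    rw [mul_pow, hsq]
  have hsupp : (Finset.univ.filter (m · ≠ 0)).card ≤ s := by
    refine (Finset.card_le_card fun j => ?_).trans hsp
    simp only [Finset.mem_filter, Finset.mem_univ, true_and, hm]
    exact right_ne_zero_of_mul
  set Q : (Fin n → Fin p → ℝ) → ℝ := fun E =>
    ∑ j, m j ^ 2 * (2 / G * ∑ g ∈ Finset.range G, (1 + blockStat p n b g E j ^ 2)) with hQ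
  have hterm : ∀ j, ∀ g ∈ Finset.range G,
      Integrable (fun E => 1 + blockStat p n b g E j ^ 2) P := fun j g _ =>
    (integrable_const 1).add ((h j).integrable_sq _)
  have htermle : ∀ j, ∀ g ∈ Finset.range G, ∫ E, (1 + blockStat p n b g E j ^ 2) ∂P ≤ 2 := by
    intro j g hg
    have hint : Integrable (fun E => blockStat p n b g E j ^ 2) P := (h j).integrable_sq _
    have e : ∫ E, blockStat p n b g E j ^ 2 ∂P = ∑ t, contrast n b g t ^ 2 :=
      (h j).integral_sq (contrast n b g)
    rw [integral_add (integrable_const 1) hint, e]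
    have hle : ∑ t, contrast n b g t ^ 2 ≤ 1 := by
      refine sum_contrast_sq_le hb ?_
      have : (g + 1) * b ≤ G * b := Nat.mul_le_mul_right b (Finset.mem_range.1 hg)
      rw [mul_comm G b] at this
      omega
    simp only [integral_const, probReal_univ, smul_eq_mul]
    linarith
  have hinner : ∀ j, Integrable (fun E => m j ^ 2 *
      (2 / G * ∑ g ∈ Finset.range G, (1 + blockStat p n b g E j ^ 2))) P := fun j =>
    ((integrable_finsetSum _ (hterm j)).const_mul _).const_mul _
  have hQint : Integrable Q P := integrable_finsetSum _ fun j _ => hinner j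
  have hQle : ∫ E, Q E ∂P ≤ 4 * M := by
    rw [hQ, integral_finsetSum _ fun j _ => hinner j, hMm, Finset.mul_sum]
    refine Finset.sum_le_sum fun j _ => ?_
    rw [integral_const_mul, integral_const_mul, integral_finsetSum _ (hterm j)]
    have : ∑ g ∈ Finset.range G, ∫ E, (1 + blockStat p n b g E j ^ 2) ∂P ≤ (G : ℝ) * 2 := by
      refine (Finset.sum_le_sum (htermle j)).trans ?_
      simp
    calc m j ^ 2 * (2 / G * ∑ g ∈ Finset.range G, ∫ E, (1 + blockStat p n b g E j ^ 2) ∂P)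
        ≤ m j ^ 2 * (2 / G * (G * 2)) := by gcongr
      _ = 4 * m j ^ 2 := by field_simp; ring
  have hQ0 : ∀ E, 0 ≤ Q E := fun E => Finset.sum_nonneg fun j _ => by positivity
  have hle : ∀ E, 1 - scanTest p n s c (θ + E) ≤ s * (1 + c) / M ^ 2 * Q E := by
    intro E
    by_cases hex : excessStat p n b G c (θ + E) ≤ s
    · have key := sq_sum_le_of_excessStat_le hG hc (X := θ + E) (N := E) hsupp
        (fun g hg j => by
          rw [blockStat_add, blockStat_change hb hg (hbG.trans h1) (by omega) hθ₁ hθ₂ j])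
        hMm hex
      have h3 : 0 ≤ scanTest p n s c (θ + E) := by
        rw [scanTest]
        split_ifs <;> norm_num
      have h4 : 1 ≤ s * (1 + c) / M ^ 2 * Q E := by
        rw [div_mul_eq_mul_div, one_le_div (by positivity)]
        exact key
      linarith
    · have h3 : scanTest p n s c (θ + E) = 1 := if_pos ⟨k, hk, not_le.1 hex⟩
      rw [h3, sub_self]
      exact mul_nonneg (by positivity) (hQ0 E)
  have hnn : ∀ E, 0 ≤ 1 - scanTest p n s c (θ + E) := by
    intro E
    rw [scanTest]
    split_ifs <;> norm_num
  refine (integral_mono_of_nonneg (ae_of_all _ hnn) (hQint.const_mul _)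
    (ae_of_all _ hle)).trans ?_
  rw [integral_const_mul]
  calc s * (1 + c) / M ^ 2 * ∫ E, Q E ∂P ≤ s * (1 + c) / M ^ 2 * (4 * M) := by gcongr
    _ = 4 * (s * (1 + c)) / M := by field_simp

end Test

section Rates

lemma LL_nonneg (n : ℕ) : 0 ≤ LL n := by
  rcases Nat.eq_zero_or_pos n with rfl | hn
  · simp [LL]
  · refine Real.log_nonneg ?_
    rw [Real.le_log_iff_exp_le (by positivity)]
    have : (1 : ℝ) ≤ n := by exact_mod_cast hn
    linarith [Real.exp_one_lt_d9]

lemma log_exp_mul_div {p s : ℕ} (hs : 1 ≤ s) (hsp : s ≤ p) :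
    Real.log (Real.exp 1 * (p : ℝ) / s) = 1 + Real.log ((p : ℝ) / s) := by
  have hs' : (0 : ℝ) < s := by exact_mod_cast hs
  have hp' : (0 : ℝ) < p := by exact_mod_cast hs.trans hsp
  rw [mul_div_assoc, Real.log_mul (Real.exp_pos 1).ne' (by positivity), Real.log_exp]

lemma one_le_log_exp_mul_div {p s : ℕ} (hs : 1 ≤ s) (hsp : s ≤ p) :
    1 ≤ Real.log (Real.exp 1 * (p : ℝ) / s) := by
  rw [log_exp_mul_div hs hsp, le_add_iff_nonneg_right]
  refine Real.log_nonneg ((one_le_div (by exact_mod_cast hs)).2 (by exact_mod_cast hsp))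

lemma log_exp_sq_mul_div {p s : ℕ} (hs : 1 ≤ s) (hsp : s ≤ p) :
    Real.log (Real.exp 1 ^ 2 * (p : ℝ) / s) = 1 + Real.log (Real.exp 1 * (p : ℝ) / s) := by
  have hs' : (0 : ℝ) < s := by exact_mod_cast hs
  have hp' : (0 : ℝ) < p := by exact_mod_cast hs.trans hsp
  rw [← Real.log_exp 1, ← Real.log_mul (Real.exp_pos 1).ne' (by positivity), Real.log_exp]
  congr 1
  ring

lemma div_le_exp_log {p s : ℕ} (hs : 1 ≤ s) (hsp : s ≤ p) :
    (p : ℝ) / s ≤ Real.exp (Real.log (Real.exp 1 * (p : ℝ) / s)) := by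
  have hs' : (0 : ℝ) < s := by exact_mod_cast hs
  have hp' : (0 : ℝ) < p := by exact_mod_cast hs.trans hsp
  rw [log_exp_mul_div hs hsp, Real.exp_add, Real.exp_log (by positivity)]
  exact le_mul_of_one_le_left (by positivity) (Real.one_le_exp zero_le_one)

lemma div_mul_exp_neg_numBlocks_le {p n s k : ℕ} (hs : 1 ≤ s) (hsp : s ≤ p)
    (hk : k ∈ scales p n s) (hn : 0 < n) :
    (p : ℝ) / s * Real.exp (-(numBlocks p n s k : ℝ)) ≤
      2 * (1 / 2) ^ k + 1 / Real.log (8 * n) := by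
  have h2L := (Finset.mem_filter.1 hk).2
  have hps := div_le_exp_log hs hsp
  have hn' : (1 : ℝ) ≤ n := by exact_mod_cast hn
  have hlog : 0 < Real.log (8 * n) := Real.log_pos (by linarith)
  set L := Real.log (Real.exp 1 * (p : ℝ) / s) with hL
  have hG : Real.exp (-(numBlocks p n s k : ℝ)) ≤
      Real.exp (-2 ^ k) + Real.exp (-(L + LL n)) := by
    rw [numBlocks, Nat.cast_min, ← max_neg_neg, Real.exp_monotone.map_max]
    refine max_le ?_ ?_
    · push_cast
      exact le_add_of_nonneg_right (Real.exp_pos _).le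
    · refine le_add_of_nonneg_of_le (Real.exp_pos _).le (Real.exp_le_exp.2 (neg_le_neg ?_))
      push_cast
      linarith [Nat.le_ceil (L + LL n)]
  have hA : Real.exp L * Real.exp (-2 ^ k) ≤ 2 * (1 / 2) ^ k := by
    have h2k : (0 : ℝ) < 2 ^ k := by positivity
    have h3 : (2 : ℝ) ^ k / 2 ≤ Real.exp (2 ^ k / 2) := by
      linarith [Real.add_one_le_exp ((2 : ℝ) ^ k / 2)]
    calc Real.exp L * Real.exp (-2 ^ k) = Real.exp (L - 2 ^ k) := by
          rw [← Real.exp_add, sub_eq_add_neg]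
      _ ≤ Real.exp (-(2 ^ k / 2)) := Real.exp_le_exp.2 (by linarith)
      _ = (Real.exp (2 ^ k / 2))⁻¹ := Real.exp_neg _
      _ ≤ ((2 : ℝ) ^ k / 2)⁻¹ := inv_anti₀ (by positivity) h3
      _ = 2 * (1 / 2) ^ k := by rw [inv_div, one_div, inv_pow]; ring
  have hB : Real.exp L * Real.exp (-(L + LL n)) = 1 / Real.log (8 * n) := by
    rw [← Real.exp_add, show L + -(L + LL n) = -LL n by ring, Real.exp_neg, LL,
      Real.exp_log hlog, one_div]
  calc (p : ℝ) / s * Real.exp (-(numBlocks p n s k : ℝ))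
      ≤ Real.exp L * (Real.exp (-2 ^ k) + Real.exp (-(L + LL n))) := by gcongr
    _ ≤ 2 * (1 / 2) ^ k + 1 / Real.log (8 * n) := by rw [mul_add, hB]; gcongr

lemma two_le_numBlocks {p n s k : ℕ} (hs : 1 ≤ s) (hsp : s ≤ p) (hk : k ∈ scales p n s) :
    2 ≤ numBlocks p n s k := by
  refine le_min ?_ (by omega)
  have h := (Finset.mem_filter.1 hk).2
  have h1 := one_le_log_exp_mul_div hs hsp
  have : (2 : ℝ) ≤ 2 ^ k := by linarith
  exact_mod_cast this

lemma log_two_le_two_mul_log {n : ℕ} (hn : 0 < n) :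
    (Nat.log 2 n : ℝ) ≤ 2 * Real.log (8 * n) := by
  have hn' : (1 : ℝ) ≤ n := by exact_mod_cast hn
  have h1 : ((2 : ℝ) ^ Nat.log 2 n) ≤ 8 * n := by
    have : ((2 : ℝ) ^ Nat.log 2 n) ≤ n := by exact_mod_cast Nat.pow_log_le_self 2 hn.ne'
    linarith
  have h2 := Real.log_le_log (by positivity) h1
  rw [Real.log_pow] at h2
  have h3 : (0 : ℝ) ≤ Nat.log 2 n := Nat.cast_nonneg _
  nlinarith [Real.log_two_gt_d9]

/-- Total false-alarm bound over all scales. -/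
lemma sum_scales_le {p n s : ℕ} (hs : 1 ≤ s) (hsp : s ≤ p) {D : ℝ} (hD : 1 ≤ D) :
    ∑ k ∈ scales p n s, (p : ℝ) / s * (2 * Real.exp 1 * D *
      (2 / (2 * Real.exp 1 * D)) ^ numBlocks p n s k) ≤ 36 / D := by
  rcases Nat.eq_zero_or_pos n with rfl | hn
  · simp only [scales, Nat.log_zero_right, Finset.range_zero, Finset.filter_empty,
      Finset.sum_empty]
    positivity
  have hn' : (1 : ℝ) ≤ n := by exact_mod_cast hn
  have hlog : 0 < Real.log (8 * n) := Real.log_pos (by linarith)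
  have hD0 : 0 < D := by linarith
  have hterm : ∀ k ∈ scales p n s, (p : ℝ) / s * (2 * Real.exp 1 * D *
      (2 / (2 * Real.exp 1 * D)) ^ numBlocks p n s k) ≤
        2 * Real.exp 1 / D * (2 * (1 / 2) ^ k + 1 / Real.log (8 * n)) := by
    intro k hk
    have e1 : (2 / (2 * Real.exp 1 * D)) ^ numBlocks p n s k =
        Real.exp (-(numBlocks p n s k : ℝ)) * D⁻¹ ^ numBlocks p n s k := by
      rw [← mul_one (numBlocks p n s k : ℝ), ← mul_neg, Real.exp_nat_mul, ← mul_pow,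
        Real.exp_neg]
      congr 1
      field_simp
    have e2 : D⁻¹ ^ numBlocks p n s k ≤ D⁻¹ ^ 2 :=
      pow_le_pow_of_le_one (by positivity) (inv_le_one_of_one_le₀ hD)
        (two_le_numBlocks hs hsp hk)
    calc (p : ℝ) / s * (2 * Real.exp 1 * D * (2 / (2 * Real.exp 1 * D)) ^ numBlocks p n s k)
        = (p : ℝ) / s * Real.exp (-(numBlocks p n s k : ℝ)) *
            (2 * Real.exp 1 * D * D⁻¹ ^ numBlocks p n s k) := by rw [e1]; ring
      _ ≤ (2 * (1 / 2) ^ k + 1 / Real.log (8 * n)) * (2 * Real.exp 1 * D * D⁻¹ ^ 2) := by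
          gcongr
          exact div_mul_exp_neg_numBlocks_le hs hsp hk hn
      _ = 2 * Real.exp 1 / D * (2 * (1 / 2) ^ k + 1 / Real.log (8 * n)) := by field_simp
  have hsub : scales p n s ⊆ Finset.range (Nat.log 2 n) := Finset.filter_subset _ _
  have hgeom : ∑ k ∈ scales p n s, (2 * (1 / 2 : ℝ) ^ k + 1 / Real.log (8 * n)) ≤ 6 := by
    refine (Finset.sum_le_sum_of_subset_of_nonneg hsub fun k _ _ => by positivity).trans ?_
    rw [Finset.sum_add_distrib, ← Finset.mul_sum, Finset.sum_const, Finset.card_range,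
      nsmul_eq_mul, mul_one_div]
    have h1 := sum_geometric_two_le (Nat.log 2 n)
    have h2 : (Nat.log 2 n : ℝ) / Real.log (8 * n) ≤ 2 :=
      (div_le_iff₀ hlog).2 (log_two_le_two_mul_log hn)
    linarith
  calc _ ≤ ∑ k ∈ scales p n s,
        2 * Real.exp 1 / D * (2 * (1 / 2) ^ k + 1 / Real.log (8 * n)) := Finset.sum_le_sum hterm
    _ ≤ 2 * Real.exp 1 / D * 6 := by rw [← Finset.mul_sum]; gcongr
    _ ≤ 2 * 3 / D * 6 := by gcongr; linarith [Real.exp_one_lt_d9]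
    _ = 36 / D := by ring

lemma numBlocks_le {p n s : ℕ} (hs : 1 ≤ s) (hsp : s ≤ p) (k : ℕ) :
    (numBlocks p n s k : ℝ) ≤ 4 * (Real.log (Real.exp 1 * (p : ℝ) / s) + LL n) := by
  have h1 := one_le_log_exp_mul_div hs hsp
  have h2 := LL_nonneg n
  have h3 : (numBlocks p n s k : ℝ) ≤
      ⌈Real.log (Real.exp 1 * (p : ℝ) / s) + LL n⌉₊ + 2 := by
    exact_mod_cast min_le_right _ _
  linarith [Nat.ceil_lt_add_one (show 0 ≤ Real.log (Real.exp 1 * (p : ℝ) / s) + LL n by linarith)]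

/-- A change away from the boundary is detected at some scanned scale, where the block signal
dominates the sparsity. -/
lemma exists_scale {p n s : ℕ} (hs : 1 ≤ s) (hsp : s ≤ p) {t0 : ℕ} {v ρ C : ℝ} (hC : 0 < C)
    (hlow : tRes p n s + 1 ≤ t0) (hupp : (t0 : ℝ) ≤ n - tRes p n s)
    (hρ : C * s * (Real.log (Real.exp 1 * (p : ℝ) / s) + LL n) ≤ ρ ^ 2)
    (hv : ρ ^ 2 ≤ (t0 : ℝ) * (n - t0) / n * v) :
    ∃ k ∈ scales p n s, 2 ^ k ≤ t0 ∧ t0 + 2 ^ k ≤ n ∧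
      C * s / 32 ≤ blockLen p n s k / 2 * v := by
  have hL := one_le_log_exp_mul_div hs hsp
  have hLL := LL_nonneg n
  have hs' : (0 : ℝ) < s := by exact_mod_cast hs
  have htres : 32 * (1 + Real.log (Real.exp 1 * (p : ℝ) / s)) ≤ tRes p n s := by
    rw [tRes, log_exp_sq_mul_div hs hsp]
    linarith [div_nonneg hLL hs'.le]
  have ht0n : t0 ≤ n := by
    have : (t0 : ℝ) ≤ n := by linarith
    exact_mod_cast this
  obtain ⟨r, rfl⟩ := Nat.exists_eq_add_of_le ht0n
  have hτ : 32 * (1 + Real.log (Real.exp 1 * (p : ℝ) / s)) ≤ (min t0 r : ℕ) := by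
    rw [Nat.cast_min]
    refine le_min (by linarith) ?_
    push_cast at hupp
    linarith
  set τ := min t0 r with hτdef
  have hτ0 : 0 < τ := by
    have : (0 : ℝ) < τ := by linarith
    exact_mod_cast this
  have hk1 : 2 ^ Nat.log 2 τ ≤ τ := Nat.pow_log_le_self 2 hτ0.ne'
  have hk2 : τ < 2 * 2 ^ Nat.log 2 τ := by
    rw [← pow_succ']
    exact Nat.lt_pow_succ_log_self (by norm_num) τ
  have hτt : τ ≤ t0 := min_le_left _ _
  have hτr : τ ≤ r := min_le_right _ _
  set k := Nat.log 2 τ with hkdef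
  have hk2' : (τ : ℝ) ≤ 2 * 2 ^ k := by exact_mod_cast hk2.le
  refine ⟨k, ?_, by omega, by omega, ?_⟩
  · refine Finset.mem_filter.2 ⟨Finset.mem_range.2 ?_, by linarith⟩
    refine Nat.lt_of_succ_le (Nat.le_log_of_pow_le (by norm_num) ?_)
    rw [pow_succ']
    omega
  · have hN0 : (0 : ℝ) < (t0 + r : ℕ) := by exact_mod_cast (by omega : 0 < t0 + r)
    have hρ0 : 0 < ρ ^ 2 := lt_of_lt_of_le (by positivity) hρ
    have hw0 : 0 ≤ (t0 : ℝ) * ((t0 + r : ℕ) - t0) / (t0 + r : ℕ) := by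
      push_cast
      rw [add_sub_cancel_left]
      positivity
    have hv0 : 0 < v := by
      by_contra! hneg
      linarith [mul_nonpos_of_nonneg_of_nonpos hw0 hneg]
    have hw : (t0 : ℝ) * ((t0 + r : ℕ) - t0) / (t0 + r : ℕ) ≤ τ := by
      rw [div_le_iff₀ hN0]
      push_cast
      rw [add_sub_cancel_left]
      have a1 : (0 : ℝ) ≤ t0 := Nat.cast_nonneg _
      have a2 : (0 : ℝ) ≤ r := Nat.cast_nonneg _
      rw [hτdef, Nat.cast_min]
      rcases le_total (t0 : ℝ) r with hle | hle
      · rw [min_eq_left hle]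
        nlinarith
      · rw [min_eq_right hle]
        nlinarith
    have hG := numBlocks_le (n := t0 + r) hs hsp k
    have hG0 : (1 : ℝ) ≤ numBlocks p (t0 + r) s k := by
      exact_mod_cast one_le_numBlocks p (t0 + r) s k
    have hbG : (2 : ℝ) ^ k ≤ 2 * (blockLen p (t0 + r) s k * numBlocks p (t0 + r) s k) := by
      exact_mod_cast le_two_mul_blockLen_mul_numBlocks p (t0 + r) s k
    set G : ℝ := ((numBlocks p (t0 + r) s k : ℕ) : ℝ)
    set b : ℝ := ((blockLen p (t0 + r) s k : ℕ) : ℝ)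
    have hG' : 0 < G := by linarith
    refine le_of_mul_le_mul_right ?_ hG'
    calc C * s / 32 * G
        ≤ C * s / 32 * (4 * (Real.log (Real.exp 1 * (p : ℝ) / s) + LL (t0 + r))) := by gcongr
      _ = C * s * (Real.log (Real.exp 1 * (p : ℝ) / s) + LL (t0 + r)) / 8 := by ring
      _ ≤ τ * v / 8 := by
          have : ρ ^ 2 ≤ τ * v := hv.trans (by gcongr)
          linarith
      _ ≤ (4 * (b * G)) * v / 8 := by
          have : (τ : ℝ) ≤ 4 * (b * G) := by linarith
          gcongr
      _ = b / 2 * v * G := by ring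

end Rates

/-- Theorem: change away from the boundary, finite-moment noise. -/
theorem statement_13 (α K ε : ℝ) (hα : 4 ≤ α) (hK : 0 < K) (hε0 : 0 < ε) (hε1 : ε < 1) :
    ∃ C : ℝ, 0 < C ∧
      ∀ p n s : ℕ, 0 < p → 1 ≤ s → s ≤ p →
        ∃ φ : (Fin n → Fin p → ℝ) → ℝ, IsTest p n φ ∧
          ∀ ρ : ℝ,
            C * (s : ℝ) * (Real.log (Real.exp 1 * (p : ℝ) / (s : ℝ)) + LL n) ≤ ρ ^ 2 →
            risk p n (Pclass p n α K) (ThetaRes p n s ρ (tRes p n s)) φ ≤ ε := by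
  set D : ℝ := 72 / ε with hD
  have hD1 : 1 ≤ D := by
    rw [hD, le_div_iff₀ hε0]
    linarith
  set c : ℝ := 2 * Real.exp 1 * D with hc
  have hc0 : 0 < c := by positivity
  refine ⟨256 * (1 + c) / ε, by positivity, fun p n s hp hs hsp =>
    ⟨scanTest p n s c, isTest_scanTest p n s c, fun ρ hρ => ?_⟩⟩
  have hs' : (0 : ℝ) < s := by exact_mod_cast hs
  have hε2 : 0 ≤ ε / 2 := by positivity
  rw [risk, ← add_halves ε]
  refine add_le_add ?_ ?_
  · refine Real.iSup_le (fun P => Real.iSup_le (fun hP => Real.iSup_le (fun θ =>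
      Real.iSup_le (fun hθ => ?_) hε2) hε2) hε2) hε2
    obtain ⟨hprob, hwhite⟩ := isWhite_of_mem_Pclass hP
    refine (integral_scanTest_null_le hs hc0 hwhite hθ).trans
      ((sum_scales_le hs hsp hD1).trans (le_of_eq ?_))
    rw [hD]
    field_simp
    norm_num
  · refine Real.iSup_le (fun P => Real.iSup_le (fun hP => Real.iSup_le (fun θ =>
      Real.iSup_le (fun hθ => ?_) hε2) hε2) hε2) hε2
    obtain ⟨hprob, hwhite⟩ := isWhite_of_mem_Pclass hP
    obtain ⟨t0, hlow, hupp, μ₁, μ₂, hθ₁, hθ₂, hl0, hv⟩ := hθ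
    obtain ⟨k, hk, h1, h2, hM⟩ := exists_scale hs hsp (by positivity) hlow hupp hρ hv
    have hM0 : 0 < 256 * (1 + c) / ε * s / 32 := by positivity
    refine (integral_one_sub_scanTest_le hk hc0 hwhite h1 h2 hθ₁ hθ₂ hl0
      (hM0.trans_le hM) rfl).trans ?_
    calc _ ≤ 4 * (s * (1 + c)) / (256 * (1 + c) / ε * s / 32) := by gcongr
      _ = ε / 2 := by field_simp; norm_num

end ChangePoint
end
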